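/- arXiv:cs/0005009 — 2 statements merged into one kernel-verified Lean document; each statement's English description precedes it below -/
import Mathlib

section
/- Correctness of the standard algorithm (Hollunder–Baader): a Gr(K_R)-formula φ in NNF is satisfiable if and only if {x₀ ⊨ φ} can be transformed into a complete and clash-free constraint system using the standard completion rules; moreover, each sequence of applications of these rules is finite. -/
/-! Core definitions for the graded modal logic Gr(K_R):
syntax, Kripke semantics, NNF, closure, constraint systems,
and the completion rules (optimised and standard). -/

namespace GrK

/-- Gr(K_R)-formulae over propositional atoms (ℕ) and relation names (ℕ).
`ge r n φ` is the counting modality ⟨R⟩_{≥n}φ and `le r n φ` is ⟨R⟩_{≤n}φ. -/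
inductive GFormula : Type where
  | atom : ℕ → GFormula
  | neg  : GFormula → GFormula
  | and  : GFormula → GFormula → GFormula
  | or   : GFormula → GFormula → GFormula
  | ge   : ℕ → ℕ → GFormula → GFormula
  | le   : ℕ → ℕ → GFormula → GFormula
  deriving DecidableEq

/-- A Kripke structure: a nonempty type of worlds, an accessibility relation
for each relation name, and a valuation. -/
structure Kripke where
  W : Type
  nonempty : Nonempty W
  rel : ℕ → W → W → Prop
  val : ℕ → Set W

/-- Satisfaction `M, x ⊨ φ`; the graded modalities count successors
(as a cardinal, to handle infinite structures faithfully). -/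
def GFormula.sat (M : Kripke) : GFormula → M.W → Prop
  | .atom p, x => x ∈ M.val p
  | .neg φ, x => ¬ GFormula.sat M φ x
  | .and φ ψ, x => GFormula.sat M φ x ∧ GFormula.sat M ψ x
  | .or φ ψ, x => GFormula.sat M φ x ∨ GFormula.sat M ψ x
  | .ge r n φ, x => (n : Cardinal) ≤ Cardinal.mk {y : M.W // M.rel r x y ∧ GFormula.sat M φ y}
  | .le r n φ, x => Cardinal.mk {y : M.W // M.rel r x y ∧ GFormula.sat M φ y} ≤ (n : Cardinal)

/-- ♯R^M(x,φ): the number of R-successors of x satisfying φ. -/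
def Kripke.count (M : Kripke) (r : ℕ) (x : M.W) (φ : GFormula) : Cardinal :=
  Cardinal.mk {y : M.W // M.rel r x y ∧ GFormula.sat M φ y}

/-- A formula is satisfiable iff it holds at some world of some Kripke structure. -/
def GFormula.satisfiable (φ : GFormula) : Prop :=
  ∃ (M : Kripke) (x : M.W), GFormula.sat M φ x

/-- Negation normal form: negation occurs only in front of atoms. -/
def GFormula.isNNF : GFormula → Prop
  | .atom _ => True
  | .neg (.atom _) => True
  | .neg _ => False
  | .and φ ψ => GFormula.isNNF φ ∧ GFormula.isNNF ψ
  | .or φ ψ => GFormula.isNNF φ ∧ GFormula.isNNF ψ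
  | .ge _ _ φ => GFormula.isNNF φ
  | .le _ _ φ => GFormula.isNNF φ

/-- ~φ : the NNF of the negation of an NNF formula. -/
def GFormula.nnfNeg : GFormula → GFormula
  | .atom p => .neg (.atom p)
  | .neg φ => φ
  | .and φ ψ => .or φ.nnfNeg ψ.nnfNeg
  | .or φ ψ => .and φ.nnfNeg ψ.nnfNeg
  | .ge r n φ => if n = 0 then .and (.atom 0) (.neg (.atom 0)) else .le r (n - 1) φ
  | .le r n φ => .ge r (n + 1) φ

/-- |φ| : the length of a formula. -/
def GFormula.size : GFormula → ℕ
  | .atom _ => 1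
  | .neg φ => 1 + φ.size
  | .and φ ψ => 1 + φ.size + ψ.size
  | .or φ ψ => 1 + φ.size + ψ.size
  | .ge _ _ φ => 1 + φ.size
  | .le _ _ φ => 1 + φ.size

/-- sub(φ) : the set of subformulae of φ. -/
def GFormula.sub : GFormula → Finset GFormula
  | .atom p => {.atom p}
  | .neg φ => insert (.neg φ) φ.sub
  | .and φ ψ => insert (.and φ ψ) (φ.sub ∪ ψ.sub)
  | .or φ ψ => insert (.or φ ψ) (φ.sub ∪ ψ.sub)
  | .ge r n φ => insert (.ge r n φ) φ.sub
  | .le r n φ => insert (.le r n φ) φ.sub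

/-- Membership in clos(φ): the smallest set containing φ, closed under
immediate subformulae of ∧, ∨ and the graded modalities, and closed under ~. -/
inductive InClos (φ : GFormula) : GFormula → Prop
  | base : InClos φ φ
  | andL {ψ₁ ψ₂} : InClos φ (.and ψ₁ ψ₂) → InClos φ ψ₁
  | andR {ψ₁ ψ₂} : InClos φ (.and ψ₁ ψ₂) → InClos φ ψ₂
  | orL {ψ₁ ψ₂} : InClos φ (.or ψ₁ ψ₂) → InClos φ ψ₁
  | orR {ψ₁ ψ₂} : InClos φ (.or ψ₁ ψ₂) → InClos φ ψ₂
  | ge {r n ψ} : InClos φ (.ge r n ψ) → InClos φ ψ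
  | le {r n ψ} : InClos φ (.le r n ψ) → InClos φ ψ
  | nnfNeg {ψ} : InClos φ ψ → InClos φ ψ.nnfNeg

/-- clos(φ) as a set of formulae. -/
def clos (φ : GFormula) : Set GFormula := {ψ | InClos φ ψ}

/-- A constraint: either `x ⊨ ψ` or `R x y`;
a constraint system (c.s.) is a finite set of constraints. -/
inductive Constraint : Type where
  | sat : ℕ → GFormula → Constraint
  | rel : ℕ → ℕ → ℕ → Constraint
  deriving DecidableEq

/-- The variables occurring in a constraint. -/
def Constraint.vars : Constraint → Finset ℕ
  | .sat x _ => {x}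
  | .rel _ x y => {x, y}

/-- ♯R^S(x,ψ): the number of variables y with {Rxy, y ⊨ ψ} ⊆ S. -/
noncomputable def countS (S : Finset Constraint) (r x : ℕ) (ψ : GFormula) : ℕ :=
  Set.ncard {y : ℕ | Constraint.rel r x y ∈ S ∧ Constraint.sat y ψ ∈ S}

/-- A clash: {x ⊨ p, x ⊨ ¬p} ⊆ S, or x ⊨ ⟨R⟩_{≤n}ψ ∈ S with ♯R^S(x,ψ) > n. -/
def hasClash (S : Finset Constraint) : Prop :=
  (∃ x p, Constraint.sat x (.atom p) ∈ S ∧ Constraint.sat x (.neg (.atom p)) ∈ S) ∨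
  (∃ x r n ψ, Constraint.sat x (.le r n ψ) ∈ S ∧ n < countS S r x ψ)

/-- `y` is a fresh variable w.r.t. S. -/
def freshIn (y : ℕ) (S : Finset Constraint) : Prop := ∀ c ∈ S, y ∉ c.vars

/-- The →∧-rule is applicable to a constraint for x in S. -/
def andApplicable (S : Finset Constraint) (x : ℕ) : Prop :=
  ∃ ψ₁ ψ₂, Constraint.sat x (.and ψ₁ ψ₂) ∈ S ∧
    ¬ (Constraint.sat x ψ₁ ∈ S ∧ Constraint.sat x ψ₂ ∈ S)

/-- The →∨-rule is applicable to a constraint for x in S. -/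
def orApplicable (S : Finset Constraint) (x : ℕ) : Prop :=
  ∃ ψ₁ ψ₂, Constraint.sat x (.or ψ₁ ψ₂) ∈ S ∧
    Constraint.sat x ψ₁ ∉ S ∧ Constraint.sat x ψ₂ ∉ S

/-- One application of the →∧-rule. -/
inductive StepAnd : Finset Constraint → Finset Constraint → Prop
  | mk (S : Finset Constraint) (x : ℕ) (ψ₁ ψ₂ : GFormula)
      (h : Constraint.sat x (.and ψ₁ ψ₂) ∈ S)
      (h2 : ¬ (Constraint.sat x ψ₁ ∈ S ∧ Constraint.sat x ψ₂ ∈ S)) :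
      StepAnd S (insert (Constraint.sat x ψ₁) (insert (Constraint.sat x ψ₂) S))

/-- One application of the →∨-rule. -/
inductive StepOr : Finset Constraint → Finset Constraint → Prop
  | mk (S : Finset Constraint) (x : ℕ) (ψ₁ ψ₂ χ : GFormula)
      (h : Constraint.sat x (.or ψ₁ ψ₂) ∈ S)
      (h1 : Constraint.sat x ψ₁ ∉ S) (h2 : Constraint.sat x ψ₂ ∉ S)
      (hχ : χ = ψ₁ ∨ χ = ψ₂) :
      StepOr S (insert (Constraint.sat x χ) S)

/-- One application of the optimised →≥-rule: if x ⊨ ⟨R⟩_{≥n}ψ ∈ S,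
♯R^S(x,ψ) < n and no →∧/→∨ rule applies to a constraint for x, add (for a
fresh y) the constraints Rxy, y ⊨ ψ, and y ⊨ χᵢ with χᵢ ∈ {ψᵢ, ~ψᵢ} for every
ψᵢ occurring in a graded constraint ⟨R⟩_{⋈m}ψᵢ for x with the same relation R. -/
inductive StepGe : Finset Constraint → Finset Constraint → Prop
  | mk (S S' : Finset Constraint) (x r n : ℕ) (ψ : GFormula) (y : ℕ)
      (f : GFormula → GFormula)
      (h : Constraint.sat x (.ge r n ψ) ∈ S)
      (hc : countS S r x ψ < n)
      (hna : ¬ andApplicable S x) (hno : ¬ orApplicable S x)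
      (hy : freshIn y S)
      (hf : ∀ ψ', f ψ' = ψ' ∨ f ψ' = ψ'.nnfNeg)
      (hS' : (S' : Set Constraint) = (S : Set Constraint) ∪
          {Constraint.rel r x y, Constraint.sat y ψ} ∪
          {c | ∃ ψ' m,
            (Constraint.sat x (.ge r m ψ') ∈ S ∨ Constraint.sat x (.le r m ψ') ∈ S) ∧
            c = Constraint.sat y (f ψ')}) :
      StepGe S S'

/-- One application of any optimised completion rule. -/
def OptStep (S S' : Finset Constraint) : Prop := StepAnd S S' ∨ StepOr S S' ∨ StepGe S S'

/-- The initial constraint system {x₀ ⊨ φ}. -/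
def initCS (x₀ : ℕ) (φ : GFormula) : Finset Constraint := {Constraint.sat x₀ φ}

/-- S is obtained from {x₀ ⊨ φ} by a sequence of optimised rule applications. -/
def OptReach (x₀ : ℕ) (φ : GFormula) (S : Finset Constraint) : Prop :=
  Relation.ReflTransGen OptStep (initCS x₀ φ) S

/-- A c.s. is complete iff no optimised rule is applicable. -/
def OptComplete (S : Finset Constraint) : Prop := ¬ ∃ S', OptStep S S'

/-- The edges of the graph G(S) induced by a c.s. S. -/
def edge (S : Finset Constraint) (x y : ℕ) : Prop := ∃ r, Constraint.rel r x y ∈ S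

/-- The variable x occurs in S (x is a node of G(S)). -/
def occursIn (x : ℕ) (S : Finset Constraint) : Prop := ∃ c ∈ S, x ∈ c.vars

/-- Satisfiability of a constraint system. -/
def csSat (S : Finset Constraint) : Prop :=
  ∃ (M : Kripke) (α : ℕ → M.W),
    (∀ r x y z, Constraint.rel r x y ∈ S → Constraint.rel r x z ∈ S → y ≠ z → α y ≠ α z) ∧
    (∀ x ψ, Constraint.sat x ψ ∈ S → GFormula.sat M ψ (α x)) ∧
    (∀ r x y, Constraint.rel r x y ∈ S → M.rel r (α x) (α y))

/-- The canonical structure M_S induced by a c.s. S (on the variables,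
with accessibility and valuation read off from S). -/
def canonical (S : Finset Constraint) : Kripke where
  W := ℕ
  nonempty := ⟨0⟩
  rel := fun r x y => Constraint.rel r x y ∈ S
  val := fun p => {x | Constraint.sat x (.atom p) ∈ S}

/-- Renaming a variable: `rename y z c` replaces y by z in the constraint c. -/
def Constraint.rename (y z : ℕ) : Constraint → Constraint
  | .sat x ψ => .sat (if x = y then z else x) ψ
  | .rel r a b => .rel r (if a = y then z else a) (if b = y then z else b)

/-- [z/y]S : replace every occurrence of y by z in S. -/
def renameCS (S : Finset Constraint) (y z : ℕ) : Finset Constraint :=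
  S.image (Constraint.rename y z)

/-- The replacement of y by z in S is safe. -/
def safeReplace (S : Finset Constraint) (y z : ℕ) : Prop :=
  ∀ x r n ψ, Constraint.sat x (.ge r n ψ) ∈ S → Constraint.rel r x y ∈ S →
    Constraint.rel r x z ∈ S → n ≤ countS (renameCS S y z) r x ψ

/-- One application of a standard (Hollunder–Baader) completion rule. -/
inductive StdStep : Finset Constraint → Finset Constraint → Prop
  | and (S : Finset Constraint) (x : ℕ) (ψ₁ ψ₂ : GFormula)
      (h : Constraint.sat x (.and ψ₁ ψ₂) ∈ S)
      (h2 : ¬ (Constraint.sat x ψ₁ ∈ S ∧ Constraint.sat x ψ₂ ∈ S)) :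
      StdStep S (insert (Constraint.sat x ψ₁) (insert (Constraint.sat x ψ₂) S))
  | or (S : Finset Constraint) (x : ℕ) (ψ₁ ψ₂ χ : GFormula)
      (h : Constraint.sat x (.or ψ₁ ψ₂) ∈ S)
      (h1 : Constraint.sat x ψ₁ ∉ S) (h2 : Constraint.sat x ψ₂ ∉ S)
      (hχ : χ = ψ₁ ∨ χ = ψ₂) :
      StdStep S (insert (Constraint.sat x χ) S)
  | choose (S : Finset Constraint) (x r n : ℕ) (ψ χ : GFormula) (y : ℕ)
      (h : Constraint.sat x (.ge r n ψ) ∈ S ∨ Constraint.sat x (.le r n ψ) ∈ S)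
      (hr : Constraint.rel r x y ∈ S)
      (h1 : Constraint.sat y ψ ∉ S) (h2 : Constraint.sat y ψ.nnfNeg ∉ S)
      (hχ : χ = ψ ∨ χ = ψ.nnfNeg) :
      StdStep S (insert (Constraint.sat y χ) S)
  | ge (S : Finset Constraint) (x r n : ℕ) (ψ : GFormula) (y : ℕ)
      (h : Constraint.sat x (.ge r n ψ) ∈ S)
      (hc : countS S r x ψ < n)
      (hy : freshIn y S) :
      StdStep S (insert (Constraint.rel r x y) (insert (Constraint.sat y ψ) S))
  | le (S : Finset Constraint) (x r n : ℕ) (ψ : GFormula) (y z : ℕ)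
      (h : Constraint.sat x (.le r n ψ) ∈ S)
      (hc : n < countS S r x ψ)
      (hyz : y ≠ z)
      (h1 : Constraint.rel r x y ∈ S) (h2 : Constraint.rel r x z ∈ S)
      (h3 : Constraint.sat y ψ ∈ S) (h4 : Constraint.sat z ψ ∈ S)
      (hsafe : safeReplace S y z) :
      StdStep S (renameCS S y z)

/-- S is obtained from {x₀ ⊨ φ} by a sequence of standard rule applications. -/
def StdReach (x₀ : ℕ) (φ : GFormula) (S : Finset Constraint) : Prop :=
  Relation.ReflTransGen StdStep (initCS x₀ φ) S

/-- A c.s. is complete (for the standard rules) iff no rule is applicable. -/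
def StdComplete (S : Finset Constraint) : Prop := ¬ ∃ S', StdStep S S'

end GrK

namespace GrK

open Classical in
theorem sat_nnfNeg (M : Kripke) (ψ : GFormula) :
    ∀ x : M.W, GFormula.sat M ψ.nnfNeg x ↔ ¬ GFormula.sat M ψ x := by
  induction ψ with
  | atom p => intro x; simp [GFormula.nnfNeg, GFormula.sat]
  | neg φ ih => intro x; simp [GFormula.nnfNeg, GFormula.sat]
  | and a b iha ihb =>
    intro x; simp only [GFormula.nnfNeg, GFormula.sat, iha, ihb]; tauto
  | or a b iha ihb =>
    intro x; simp only [GFormula.nnfNeg, GFormula.sat, iha, ihb]; tauto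
  | ge r n φ ih =>
    intro x
    rcases n with _ | n
    · simp [GFormula.nnfNeg, GFormula.sat]
    · simp only [GFormula.nnfNeg, GFormula.sat, Nat.succ_ne_zero, if_false, Nat.add_sub_cancel,
        not_le]
      rw [Nat.cast_succ, ← Cardinal.succ_natCast, Order.lt_succ_iff]
  | le r n φ ih =>
    intro x
    simp only [GFormula.nnfNeg, GFormula.sat, not_le]
    rw [Nat.cast_succ, ← Cardinal.succ_natCast, Order.succ_le_iff]

/-! ### Finiteness of counting sets -/

theorem finite_rel (S : Finset Constraint) (r x : ℕ) :
    {y : ℕ | Constraint.rel r x y ∈ S}.Finite := by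
  apply Set.Finite.of_injOn (f := fun y => Constraint.rel r x y) (t := (S : Set Constraint))
  · intro y hy; exact hy
  · intro a _ b _ h; simpa using h
  · exact S.finite_toSet

theorem finite_count (S : Finset Constraint) (r x : ℕ) (ψ : GFormula) :
    {y : ℕ | Constraint.rel r x y ∈ S ∧ Constraint.sat y ψ ∈ S}.Finite :=
  (finite_rel S r x).subset fun _ h => h.1

theorem countS_mono {S S' : Finset Constraint} (h : S ⊆ S') (r x : ℕ) (ψ : GFormula) :
    countS S r x ψ ≤ countS S' r x ψ :=
  Set.ncard_le_ncard (fun _ hy => ⟨h hy.1, h hy.2⟩) (finite_count S' r x ψ)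

/-! ### Soundness -/

theorem sound_aux (S : Finset Constraint) (hC : StdComplete S) (hcl : ¬ hasClash S)
    (ψ : GFormula) : ψ.isNNF → ∀ x,
      (Constraint.sat x ψ ∈ S → GFormula.sat (canonical S) ψ x) ∧
      (Constraint.sat x ψ.nnfNeg ∈ S → ¬ GFormula.sat (canonical S) ψ x) := by
  have hand : ∀ x a b, Constraint.sat x (.and a b) ∈ S →
      Constraint.sat x a ∈ S ∧ Constraint.sat x b ∈ S := by
    intro x a b h
    by_contra h2
    exact hC ⟨_, StdStep.and S x a b h h2⟩
  have hor : ∀ x a b, Constraint.sat x (.or a b) ∈ S →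
      Constraint.sat x a ∈ S ∨ Constraint.sat x b ∈ S := by
    intro x a b h
    by_contra h2
    push Not at h2
    exact hC ⟨_, StdStep.or S x a b a h h2.1 h2.2 (Or.inl rfl)⟩
  have hch : ∀ x r n ψ y, (Constraint.sat x (.ge r n ψ) ∈ S ∨ Constraint.sat x (.le r n ψ) ∈ S) →
      Constraint.rel r x y ∈ S → Constraint.sat y ψ ∈ S ∨ Constraint.sat y ψ.nnfNeg ∈ S := by
    intro x r n ψ y h hr
    by_contra h2
    push Not at h2
    exact hC ⟨_, StdStep.choose S x r n ψ ψ y h hr h2.1 h2.2 (Or.inl rfl)⟩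
  have hge : ∀ x r n ψ, Constraint.sat x (.ge r n ψ) ∈ S → n ≤ countS S r x ψ := by
    intro x r n ψ h
    by_contra h2
    push Not at h2
    obtain ⟨y, hy⟩ := Infinite.exists_notMem_finset (S.biUnion Constraint.vars)
    refine hC ⟨_, StdStep.ge S x r n ψ y h h2 ?_⟩
    intro c hc hy'
    exact hy (Finset.mem_biUnion.2 ⟨c, hc, hy'⟩)
  have hle : ∀ x r n ψ, Constraint.sat x (.le r n ψ) ∈ S → countS S r x ψ ≤ n := by
    intro x r n ψ h
    by_contra h2
    push Not at h2
    exact hcl (Or.inr ⟨x, r, n, ψ, h, h2⟩)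
  have hat : ∀ x p, Constraint.sat x (.atom p) ∈ S → Constraint.sat x (.neg (.atom p)) ∈ S →
      False := fun x p h1 h2 => hcl (Or.inl ⟨x, p, h1, h2⟩)
  -- cardinal facts
  have Hge : ∀ ψ : GFormula, (∀ x, (Constraint.sat x ψ ∈ S → GFormula.sat (canonical S) ψ x)) →
      ∀ x r n, Constraint.sat x (.ge r n ψ) ∈ S →
      GFormula.sat (canonical S) (.ge r n ψ) x := by
    intro ψ ih x r n h
    have h1 := hge x r n ψ h
    show (n : Cardinal) ≤ Cardinal.mk {y : ℕ | Constraint.rel r x y ∈ S ∧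
      GFormula.sat (canonical S) ψ y}
    have hfin : {y : ℕ | Constraint.rel r x y ∈ S ∧
      GFormula.sat (canonical S) ψ y}.Finite := (finite_rel S r x).subset fun _ h => h.1
    rw [← Set.cast_ncard hfin]
    have hsub : {y : ℕ | Constraint.rel r x y ∈ S ∧ Constraint.sat y ψ ∈ S} ⊆
      {y : ℕ | Constraint.rel r x y ∈ S ∧ GFormula.sat (canonical S) ψ y} :=
      fun y hy => ⟨hy.1, ih y hy.2⟩
    exact Nat.cast_le.2 (h1.trans (Set.ncard_le_ncard hsub hfin))
  have Hle : ∀ ψ : GFormula,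
      (∀ x, (Constraint.sat x ψ.nnfNeg ∈ S → ¬ GFormula.sat (canonical S) ψ x)) →
      ∀ x r n, Constraint.sat x (.le r n ψ) ∈ S →
      GFormula.sat (canonical S) (.le r n ψ) x := by
    intro ψ ih x r n h
    have h1 := hle x r n ψ h
    show Cardinal.mk {y : ℕ | Constraint.rel r x y ∈ S ∧
      GFormula.sat (canonical S) ψ y} ≤ (n : Cardinal)
    have hfin : {y : ℕ | Constraint.rel r x y ∈ S ∧
      GFormula.sat (canonical S) ψ y}.Finite := (finite_rel S r x).subset fun _ h => h.1
    rw [← Set.cast_ncard hfin]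
    refine Nat.cast_le.2 (le_trans ?_ h1)
    refine Set.ncard_le_ncard (fun y hy => ⟨hy.1, ?_⟩) (finite_count S r x ψ)
    rcases hch x r n ψ y (Or.inr h) hy.1 with h3 | h3
    · exact h3
    · exact absurd hy.2 (ih y h3)
  induction ψ with
  | atom p =>
    intro _ x
    refine ⟨fun h => h, fun h h' => hat x p h' h⟩
  | neg φ ih =>
    intro hN x
    cases φ with
    | atom p =>
      refine ⟨fun h h' => hat x p h' h, fun h h' => h' h⟩
    | _ => exact absurd hN (by simp [GFormula.isNNF])
  | and a b iha ihb =>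
    intro hN x
    refine ⟨fun h => ⟨(iha hN.1 x).1 (hand x a b h).1, (ihb hN.2 x).1 (hand x a b h).2⟩, ?_⟩
    intro h h'
    rcases hor x _ _ h with h1 | h1
    · exact (iha hN.1 x).2 h1 h'.1
    · exact (ihb hN.2 x).2 h1 h'.2
  | or a b iha ihb =>
    intro hN x
    refine ⟨fun h => ?_, ?_⟩
    · rcases hor x _ _ h with h1 | h1
      · exact Or.inl ((iha hN.1 x).1 h1)
      · exact Or.inr ((ihb hN.2 x).1 h1)
    intro h h'
    have h1 := hand x _ _ h
    rcases h' with h' | h'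
    · exact (iha hN.1 x).2 h1.1 h'
    · exact (ihb hN.2 x).2 h1.2 h'
  | ge r n φ ih =>
    intro hN x
    have ih' := ih hN
    refine ⟨Hge φ (fun x => (ih' x).1) x r n, fun h => ?_⟩
    by_cases hn : n = 0
    · simp only [GFormula.nnfNeg, hn, if_true] at h
      have := hand x _ _ h
      exact (hat x 0 this.1 this.2).elim
    · refine (sat_nnfNeg (canonical S) (.ge r n φ) x).1 ?_
      simp only [GFormula.nnfNeg, hn, if_false] at h ⊢
      exact Hle φ (fun x => (ih' x).2) x r _ h
  | le r n φ ih =>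
    intro hN x
    have ih' := ih hN
    refine ⟨Hle φ (fun x => (ih' x).2) x r n, fun h => ?_⟩
    refine (sat_nnfNeg (canonical S) (.le r n φ) x).1 ?_
    exact Hge φ (fun x => (ih' x).1) x r _ h

theorem reach_mem {x₀ : ℕ} {φ : GFormula} {S : Finset Constraint} (h : StdReach x₀ φ S) :
    ∃ x, Constraint.sat x φ ∈ S := by
  induction h with
  | refl => exact ⟨x₀, by simp [initCS]⟩
  | tail _ hs ih =>
    obtain ⟨x, hx⟩ := ih
    cases hs with
    | le x' r n ψ y z =>
      exact ⟨_, Finset.mem_image_of_mem (Constraint.rename y z) hx⟩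
    | _ => exact ⟨x, by simp [hx]⟩

/-! ### Completeness: a satisfiable system can be extended -/

theorem csSat_no_clash {S : Finset Constraint} (h : csSat S) : ¬ hasClash S := by
  obtain ⟨M, α, hinj, hsat, hrel⟩ := h
  rintro (⟨x, p, h1, h2⟩ | ⟨x, r, n, ψ, h1, h2⟩)
  · exact hsat _ _ h2 (hsat _ _ h1)
  · have h3 : Cardinal.mk {w : M.W // M.rel r (α x) w ∧ GFormula.sat M ψ w} ≤ n := hsat _ _ h1
    have h4 : Cardinal.mk {y : ℕ | Constraint.rel r x y ∈ S ∧ Constraint.sat y ψ ∈ S} ≤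
        Cardinal.mk {w : M.W // M.rel r (α x) w ∧ GFormula.sat M ψ w} := by
      refine Cardinal.mk_le_of_injective
        (f := fun y => ⟨α y.1, hrel _ _ _ y.2.1, hsat _ _ y.2.2⟩) ?_
      intro a b hab
      by_contra hne
      exact hinj r x a b a.2.1 b.2.1 (fun h => hne (Subtype.ext h)) (congrArg Subtype.val hab)
    rw [← Set.cast_ncard (finite_count S r x ψ)] at h4
    have h5 := h4.trans h3
    have h6 : countS S r x ψ ≤ n := Nat.cast_le.1 h5
    omega

theorem csSat_insert_sat {S : Finset Constraint} {M : Kripke} {α : ℕ → M.W}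
    (hinj : ∀ r x y z, Constraint.rel r x y ∈ S → Constraint.rel r x z ∈ S → y ≠ z → α y ≠ α z)
    (hsat : ∀ x ψ, Constraint.sat x ψ ∈ S → GFormula.sat M ψ (α x))
    (hrel : ∀ r x y, Constraint.rel r x y ∈ S → M.rel r (α x) (α y))
    {x : ℕ} {χ : GFormula} (h : GFormula.sat M χ (α x)) :
    csSat (insert (Constraint.sat x χ) S) := by
  refine ⟨M, α, ?_, ?_, ?_⟩
  · intro r a b c h1 h2
    exact hinj r a b c (by simpa using h1) (by simpa using h2)
  · intro a ψ h1
    rcases Finset.mem_insert.1 h1 with h1 | h1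
    · cases h1; exact h
    · exact hsat _ _ h1
  · intro r a b h1
    exact hrel r a b (by simpa using h1)

theorem csSat_progress {S : Finset Constraint} (h : csSat S) (hn : ¬ StdComplete S) :
    ∃ S', StdStep S S' ∧ csSat S' := by
  have hcl := csSat_no_clash h
  obtain ⟨M, α, hinj, hsat, hrel⟩ := h
  by_cases hch : ∃ x r n ψ y,
      (Constraint.sat x (.ge r n ψ) ∈ S ∨ Constraint.sat x (.le r n ψ) ∈ S) ∧
      Constraint.rel r x y ∈ S ∧ Constraint.sat y ψ ∉ S ∧ Constraint.sat y ψ.nnfNeg ∉ S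
  · obtain ⟨x, r, n, ψ, y, h, hr, h1, h2⟩ := hch
    by_cases hs : GFormula.sat M ψ (α y)
    · exact ⟨_, StdStep.choose S x r n ψ ψ y h hr h1 h2 (Or.inl rfl),
        csSat_insert_sat hinj hsat hrel hs⟩
    · exact ⟨_, StdStep.choose S x r n ψ ψ.nnfNeg y h hr h1 h2 (Or.inr rfl),
        csSat_insert_sat hinj hsat hrel ((sat_nnfNeg M ψ _).2 hs)⟩
  unfold StdComplete at hn
  push Not at hn
  obtain ⟨S', hS'⟩ := hn
  cases hS' with
  | and x ψ₁ ψ₂ h h2 =>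
    refine ⟨_, StdStep.and S x ψ₁ ψ₂ h h2, ?_⟩
    have hh : GFormula.sat M ψ₁ (α x) ∧ GFormula.sat M ψ₂ (α x) := hsat _ _ h
    refine csSat_insert_sat (M := M) (α := α) ?_ ?_ ?_ hh.1
    · intro r a b c h1 h2
      exact hinj r a b c (by simpa using h1) (by simpa using h2)
    · intro a ψ h1
      rcases Finset.mem_insert.1 h1 with h1 | h1
      · cases h1; exact hh.2
      · exact hsat _ _ h1
    · intro r a b h1
      exact hrel r a b (by simpa using h1)
  | or x ψ₁ ψ₂ χ h h1 h2 hχ =>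
    have hh : GFormula.sat M ψ₁ (α x) ∨ GFormula.sat M ψ₂ (α x) := hsat _ _ h
    rcases hh with hh | hh
    · exact ⟨_, StdStep.or S x ψ₁ ψ₂ ψ₁ h h1 h2 (Or.inl rfl),
        csSat_insert_sat hinj hsat hrel hh⟩
    · exact ⟨_, StdStep.or S x ψ₁ ψ₂ ψ₂ h h1 h2 (Or.inr rfl),
        csSat_insert_sat hinj hsat hrel hh⟩
  | choose x r n ψ χ y h hr h1 h2 hχ => exact absurd ⟨x, r, n, ψ, y, h, hr, h1, h2⟩ hch
  | le x r n ψ y z h hc => exact absurd (Or.inr ⟨x, r, n, ψ, h, hc⟩) hcl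
  | ge x r n ψ y h hc hy =>
    refine ⟨_, StdStep.ge S x r n ψ y h hc hy, ?_⟩
    have hyx : ∀ a χ, Constraint.sat a χ ∈ S → a ≠ y := by
      rintro a χ h1 rfl; exact hy _ h1 (by simp [Constraint.vars])
    have hyr : ∀ r a b, Constraint.rel r a b ∈ S → a ≠ y ∧ b ≠ y := by
      intro r a b h1
      have := hy _ h1
      simp only [Constraint.vars, Finset.mem_insert, Finset.mem_singleton, not_or] at this
      exact ⟨Ne.symm this.1, Ne.symm this.2⟩
    have hxy : x ≠ y := hyx _ _ h
    -- a new witness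
    obtain ⟨w, hw1, hw2, hw3⟩ : ∃ w, M.rel r (α x) w ∧ GFormula.sat M ψ w ∧
        ∀ b, Constraint.rel r x b ∈ S → α b ≠ w := by
      by_contra hno
      push Not at hno
      have h3 : (n : Cardinal) ≤
        Cardinal.mk {w : M.W // M.rel r (α x) w ∧ GFormula.sat M ψ w} := hsat _ _ h
      have h4 : Cardinal.mk {w : M.W // M.rel r (α x) w ∧ GFormula.sat M ψ w} ≤
          Cardinal.mk {y : ℕ | Constraint.rel r x y ∈ S ∧ Constraint.sat y ψ ∈ S} := by
        have key : ∀ w : {w : M.W // M.rel r (α x) w ∧ GFormula.sat M ψ w},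
            ∃ b : {y : ℕ | Constraint.rel r x y ∈ S ∧ Constraint.sat y ψ ∈ S}, α b.1 = w.1 := by
          rintro ⟨w, hw1, hw2⟩
          obtain ⟨b, hb, hbw⟩ := hno w hw1 hw2
          refine ⟨⟨b, hb, ?_⟩, hbw⟩
          by_contra hb2
          apply hch
          refine ⟨x, r, n, ψ, b, Or.inl h, hb, hb2, fun hb3 => ?_⟩
          have := (sat_nnfNeg M ψ _).1 (hsat _ _ hb3)
          rw [hbw] at this
          exact this hw2
        choose g hg using key
        refine Cardinal.mk_le_of_injective (f := g) ?_
        intro a b hab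
        apply Subtype.ext
        rw [← hg a, ← hg b, hab]
      rw [← Set.cast_ncard (finite_count S r x ψ)] at h4
      have h6 : n ≤ countS S r x ψ := Nat.cast_le.1 (h3.trans h4)
      omega
    refine ⟨M, Function.update α y w, ?_, ?_, ?_⟩
    · intro r' a b c h1 h2 hbc
      simp only [Finset.mem_insert, Constraint.rel.injEq, reduceCtorEq, false_or] at h1 h2
      rcases h1 with ⟨rfl, rfl, rfl⟩ | h1
      · rcases h2 with ⟨_, _, rfl⟩ | h2
        · exact absurd rfl hbc
        · rw [Function.update_self, Function.update_of_ne (hyr _ _ _ h2).2]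
          exact (hw3 c h2).symm
      · rcases h2 with ⟨rfl, rfl, rfl⟩ | h2
        · rw [Function.update_self, Function.update_of_ne (hyr _ _ _ h1).2]
          exact (hw3 b h1)
        · rw [Function.update_of_ne (hyr _ _ _ h1).2, Function.update_of_ne (hyr _ _ _ h2).2]
          exact hinj r' a b c h1 h2 hbc
    · intro a χ h1
      simp only [Finset.mem_insert, Constraint.sat.injEq, reduceCtorEq, false_or] at h1
      rcases h1 with ⟨rfl, rfl⟩ | h1
      · rw [Function.update_self]; exact hw2
      · rw [Function.update_of_ne (hyx _ _ h1)]; exact hsat _ _ h1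
    · intro r' a b h1
      simp only [Finset.mem_insert, Constraint.rel.injEq, reduceCtorEq, false_or] at h1
      rcases h1 with ⟨rfl, rfl, rfl⟩ | h1
      · rw [Function.update_self, Function.update_of_ne hxy]; exact hw1
      · rw [Function.update_of_ne (hyr _ _ _ h1).1, Function.update_of_ne (hyr _ _ _ h1).2]
        exact hrel _ _ _ h1

/-! ### Termination -/

/-- Modal depth. -/
def GFormula.mdepth : GFormula → ℕ
  | .atom _ => 0
  | .neg φ => φ.mdepth
  | .and φ ψ => max φ.mdepth ψ.mdepth
  | .or φ ψ => max φ.mdepth ψ.mdepth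
  | .ge _ _ φ => 1 + φ.mdepth
  | .le _ _ φ => 1 + φ.mdepth

theorem mdepth_nnfNeg (ψ : GFormula) : ψ.nnfNeg.mdepth ≤ ψ.mdepth := by
  induction ψ with
  | ge r n φ ih =>
    simp only [GFormula.nnfNeg]
    split <;> simp [GFormula.mdepth]
  | and a b iha ihb => simp only [GFormula.nnfNeg, GFormula.mdepth]; omega
  | or a b iha ihb => simp only [GFormula.nnfNeg, GFormula.mdepth]; omega
  | _ => simp [GFormula.nnfNeg, GFormula.mdepth]

/-- A set of formulas closed under what the rules can add. -/
structure Closed (C : Finset GFormula) : Prop where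
  and_ : ∀ a b, GFormula.and a b ∈ C → a ∈ C ∧ b ∈ C
  or_ : ∀ a b, GFormula.or a b ∈ C → a ∈ C ∧ b ∈ C
  ge_ : ∀ r n a, GFormula.ge r n a ∈ C → a ∈ C ∧ a.nnfNeg ∈ C
  le_ : ∀ r n a, GFormula.le r n a ∈ C → a ∈ C ∧ a.nnfNeg ∈ C

theorem Closed.union {C D : Finset GFormula} (hC : Closed C) (hD : Closed D) :
    Closed (C ∪ D) := by
  obtain ⟨a1, a2, a3, a4⟩ := hC
  obtain ⟨b1, b2, b3, b4⟩ := hD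
  constructor <;> intros <;> simp only [Finset.mem_union] at * <;> grind

theorem exists_closed (φ : GFormula) :
    ∃ C : Finset GFormula, Closed C ∧ φ ∈ C ∧ φ.nnfNeg ∈ C := by
  induction φ with
  | atom p =>
    refine ⟨{.atom p, .neg (.atom p)}, ?_, by simp, by simp [GFormula.nnfNeg]⟩
    constructor <;> intros <;> simp at *
  | neg φ ih =>
    obtain ⟨C, ⟨h1, h2, h3, h4⟩, h, h'⟩ := ih
    refine ⟨insert (.neg φ) C, ?_, by simp, by simp [GFormula.nnfNeg, h]⟩
    constructor <;> intros <;> simp only [Finset.mem_insert, reduceCtorEq, false_or] at * <;> grind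
  | and a b iha ihb =>
    obtain ⟨C, hC, ha, ha'⟩ := iha
    obtain ⟨D, hD, hb, hb'⟩ := ihb
    obtain ⟨h1, h2, h3, h4⟩ := hC.union hD
    refine ⟨insert (.and a b) (insert (.or a.nnfNeg b.nnfNeg) (C ∪ D)), ?_, by simp,
      by simp [GFormula.nnfNeg]⟩
    constructor <;> intros <;> simp only [Finset.mem_insert, Finset.mem_union, reduceCtorEq,
      false_or, GFormula.and.injEq, GFormula.or.injEq] at * <;> grind
  | or a b iha ihb =>
    obtain ⟨C, hC, ha, ha'⟩ := iha
    obtain ⟨D, hD, hb, hb'⟩ := ihb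
    obtain ⟨h1, h2, h3, h4⟩ := hC.union hD
    refine ⟨insert (.or a b) (insert (.and a.nnfNeg b.nnfNeg) (C ∪ D)), ?_, by simp,
      by simp [GFormula.nnfNeg]⟩
    constructor <;> intros <;> simp only [Finset.mem_insert, Finset.mem_union, reduceCtorEq,
      false_or, GFormula.and.injEq, GFormula.or.injEq] at * <;> grind
  | ge r n a ih =>
    obtain ⟨C, ⟨h1, h2, h3, h4⟩, h, h'⟩ := ih
    by_cases hn : n = 0
    · refine ⟨insert (.ge r n a) (insert (.and (.atom 0) (.neg (.atom 0)))
        (insert (.atom 0) (insert (.neg (.atom 0)) C))), ?_, by simp,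
        by simp [GFormula.nnfNeg, hn]⟩
      constructor <;> intros <;> simp only [Finset.mem_insert, reduceCtorEq,
        false_or, GFormula.and.injEq, GFormula.ge.injEq] at * <;> grind
    · refine ⟨insert (.ge r n a) (insert (.le r (n - 1) a) C), ?_, by simp,
        by simp [GFormula.nnfNeg, hn]⟩
      constructor <;> intros <;> simp only [Finset.mem_insert, reduceCtorEq,
        false_or, GFormula.le.injEq, GFormula.ge.injEq] at * <;> grind
  | le r n a ih =>
    obtain ⟨C, ⟨h1, h2, h3, h4⟩, h, h'⟩ := ih
    refine ⟨insert (.le r n a) (insert (.ge r (n + 1) a) C), ?_, by simp,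
      by simp [GFormula.nnfNeg]⟩
    constructor <;> intros <;> simp only [Finset.mem_insert, reduceCtorEq,
      false_or, GFormula.le.injEq, GFormula.ge.injEq] at * <;> grind

/-- The number of a `≥`-formula. -/
def gnum : GFormula → ℕ
  | .ge _ n _ => n
  | _ => 0

open Classical in
/-- Remaining number of generating steps. -/
noncomputable def credit (S : Finset Constraint) (x : ℕ) : GFormula → ℕ
  | .ge r n ψ => if Constraint.sat x (.ge r n ψ) ∈ S then n - countS S r x ψ else n
  | _ => 0

open Classical in
/-- Local contribution of one formula at one variable. -/
noncomputable def loc (S : Finset Constraint) (x : ℕ) (ξ : GFormula) : ℕ :=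
  (if Constraint.sat x ξ ∈ S then 0 else 1) + credit S x ξ

/-- Weight of a variable. -/
noncomputable def wt (C : Finset GFormula) (S : Finset Constraint) (x : ℕ) : ℕ :=
  1 + ∑ ξ ∈ C, loc S x ξ

/-- Bound for the weight of a variable. -/
def wtBound (C : Finset GFormula) : ℕ := 1 + ∑ ξ ∈ C, (1 + gnum ξ)

theorem wt_le (C : Finset GFormula) (S : Finset Constraint) (x : ℕ) : wt C S x ≤ wtBound C := by
  unfold wt wtBound
  gcongr with ξ hξ
  unfold loc
  have : credit S x ξ ≤ gnum ξ := by
    cases ξ <;> simp only [credit, gnum, le_refl]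
    split <;> omega
  split <;> omega

/-- Variables of a system. -/
def varsS (S : Finset Constraint) : Finset ℕ := S.biUnion Constraint.vars

/-- The termination measure. -/
noncomputable def Phi (C : Finset GFormula) (D : ℕ) (d : ℕ → ℕ) (S : Finset Constraint) : ℕ :=
  ∑ x ∈ varsS S, (wtBound C + 1) ^ (D - d x) * wt C S x

/-- The invariant of reachable systems. -/
structure TInv (C : Finset GFormula) (D : ℕ) (d : ℕ → ℕ) (S : Finset Constraint) : Prop where
  rel_ : ∀ r x y, Constraint.rel r x y ∈ S → d y = d x + 1
  mem_ : ∀ x ψ, Constraint.sat x ψ ∈ S → ψ ∈ C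
  dep_ : ∀ x ψ, Constraint.sat x ψ ∈ S → ψ.mdepth + d x ≤ D

theorem loc_mono_of {S S' : Finset Constraint} {x : ℕ}
    (h1 : ∀ ξ, Constraint.sat x ξ ∈ S → Constraint.sat x ξ ∈ S')
    (h2 : ∀ r n ψ, Constraint.sat x (.ge r n ψ) ∈ S →
      n ≤ countS S' r x ψ ∨ countS S r x ψ ≤ countS S' r x ψ) (ξ : GFormula) :
    loc S' x ξ ≤ loc S x ξ := by
  have hc : credit S' x ξ ≤ credit S x ξ := by
    cases ξ with
    | ge r n ψ =>
      simp only [credit]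
      by_cases h : Constraint.sat x (.ge r n ψ) ∈ S
      · rw [if_pos h, if_pos (h1 _ h)]
        have := h2 r n ψ h
        omega
      · rw [if_neg h]
        split <;> omega
    | _ => simp [credit]
  unfold loc
  by_cases h : Constraint.sat x ξ ∈ S
  · rw [if_pos h, if_pos (h1 _ h)]; omega
  · rw [if_neg h]
    split <;> omega

theorem loc_mono {S S' : Finset Constraint} (h : S ⊆ S') (x : ℕ) (ξ : GFormula) :
    loc S' x ξ ≤ loc S x ξ :=
  loc_mono_of (fun _ h' => h h') (fun r _ ψ _ => Or.inr (countS_mono h r x ψ)) ξ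

theorem wt_mono {S S' : Finset Constraint} (h : S ⊆ S') (C : Finset GFormula) (x : ℕ) :
    wt C S' x ≤ wt C S x := by
  unfold wt
  gcongr with ξ hξ
  exact loc_mono h x ξ

theorem wt_lt {S S' : Finset Constraint} (h : S ⊆ S') {C : Finset GFormula} {x : ℕ}
    {ξ : GFormula} (hξ : ξ ∈ C) (hl : loc S' x ξ < loc S x ξ) :
    wt C S' x < wt C S x := by
  unfold wt
  have := Finset.sum_lt_sum (fun ξ (_ : ξ ∈ C) => loc_mono h x ξ) ⟨ξ, hξ, hl⟩
  omega

theorem wt_lt_new {S S' : Finset Constraint} (h : S ⊆ S') {C : Finset GFormula} {x : ℕ}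
    {ξ : GFormula} (hξ : ξ ∈ C) (h1 : Constraint.sat x ξ ∉ S) (h2 : Constraint.sat x ξ ∈ S') :
    wt C S' x < wt C S x := by
  apply wt_lt h hξ
  have hc : credit S' x ξ ≤ credit S x ξ := by
    cases ξ with
    | ge r n ψ =>
      simp only [credit]
      rw [if_neg h1, if_pos h2]; omega
    | _ => simp [credit]
  unfold loc
  rw [if_neg h1, if_pos h2]; omega

theorem mem_varsS_sat {S : Finset Constraint} {x : ℕ} {ψ : GFormula}
    (h : Constraint.sat x ψ ∈ S) : x ∈ varsS S :=
  Finset.mem_biUnion.2 ⟨_, h, by simp [Constraint.vars]⟩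

theorem mem_varsS_rel {S : Finset Constraint} {r x y : ℕ}
    (h : Constraint.rel r x y ∈ S) : x ∈ varsS S ∧ y ∈ varsS S :=
  ⟨Finset.mem_biUnion.2 ⟨_, h, by simp [Constraint.vars]⟩,
   Finset.mem_biUnion.2 ⟨_, h, by simp [Constraint.vars]⟩⟩

theorem Phi_lt {C : Finset GFormula} {D : ℕ} {d : ℕ → ℕ} {S S' : Finset Constraint}
    (h : S ⊆ S') (hv : varsS S' = varsS S) {x : ℕ} (hx : x ∈ varsS S)
    (hw : wt C S' x < wt C S x) : Phi C D d S' < Phi C D d S := by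
  unfold Phi
  rw [hv]
  apply Finset.sum_lt_sum
  · intro i _
    exact Nat.mul_le_mul_left _ (wt_mono h C i)
  · exact ⟨x, hx, Nat.mul_lt_mul_of_pos_left hw (by positivity)⟩

theorem varsS_insert_sat {S : Finset Constraint} {x : ℕ} (hx : x ∈ varsS S) (ψ : GFormula) :
    varsS (insert (Constraint.sat x ψ) S) = varsS S := by
  unfold varsS at *
  rw [Finset.biUnion_insert]
  simpa [Constraint.vars] using hx

theorem TInv.insert_sat {C : Finset GFormula} {D : ℕ} {d : ℕ → ℕ} {S : Finset Constraint}
    (h : TInv C D d S) {x : ℕ} {ψ : GFormula} (h1 : ψ ∈ C) (h2 : ψ.mdepth + d x ≤ D) :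
    TInv C D d (insert (Constraint.sat x ψ) S) := by
  refine ⟨fun r a b hab => h.rel_ r a b (by simpa using hab), ?_, ?_⟩
  · intro a χ ha
    rcases Finset.mem_insert.1 ha with ha | ha
    · cases ha; exact h1
    · exact h.mem_ _ _ ha
  · intro a χ ha
    rcases Finset.mem_insert.1 ha with ha | ha
    · cases ha; exact h2
    · exact h.dep_ _ _ ha

theorem rename_count {S : Finset Constraint} {y z : ℕ} (hsafe : safeReplace S y z)
    {x r n : ℕ} {ψ : GFormula} (hx : x ≠ y) (h : Constraint.sat x (.ge r n ψ) ∈ S) :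
    n ≤ countS (renameCS S y z) r x ψ ∨ countS S r x ψ ≤ countS (renameCS S y z) r x ψ := by
  by_cases hb : Constraint.rel r x y ∈ S ∧ Constraint.rel r x z ∈ S
  · exact Or.inl (hsafe x r n ψ h hb.1 hb.2)
  · right
    unfold countS
    refine Set.ncard_le_ncard_of_injOn (fun b => if b = y then z else b) ?_ ?_
      (finite_count (renameCS S y z) r x ψ)
    · rintro b ⟨h1, h2⟩
      have h1' := Finset.mem_image_of_mem (Constraint.rename y z) h1
      have h2' := Finset.mem_image_of_mem (Constraint.rename y z) h2
      simp only [Constraint.rename, if_neg hx] at h1' h2'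
      exact ⟨h1', h2'⟩
    · rintro a ⟨ha, -⟩ b ⟨hb', -⟩ hab
      simp only at hab
      by_cases h1 : a = y <;> by_cases h2 : b = y
      · rw [h1, h2]
      · rw [if_pos h1, if_neg h2] at hab
        subst h1; subst hab
        exact absurd ⟨ha, hb'⟩ hb
      · rw [if_neg h1, if_pos h2] at hab
        subst h2; subst hab
        exact absurd ⟨hb', ha⟩ hb
      · rwa [if_neg h1, if_neg h2] at hab

theorem step_decreases {C : Finset GFormula} (hC : Closed C) {D : ℕ} {d : ℕ → ℕ}
    {S S' : Finset Constraint} (hI : TInv C D d S) (hs : StdStep S S') :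
    ∃ d', TInv C D d' S' ∧ Phi C D d' S' < Phi C D d S := by
  cases hs with
  | and x a b h h2 =>
    have hx := mem_varsS_sat h
    have hm := hC.and_ _ _ (hI.mem_ _ _ h)
    have hd := hI.dep_ _ _ h
    simp only [GFormula.mdepth] at hd
    have hsub : S ⊆ insert (Constraint.sat x a) (insert (Constraint.sat x b) S) :=
      (Finset.subset_insert _ _).trans (Finset.subset_insert _ _)
    refine ⟨d, (hI.insert_sat hm.2 (by omega)).insert_sat hm.1 (by omega), ?_⟩
    have hv := varsS_insert_sat hx b
    refine Phi_lt hsub ((varsS_insert_sat (hv.symm ▸ hx) a).trans hv) hx ?_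
    by_cases ha : Constraint.sat x a ∈ S
    · exact wt_lt_new hsub hm.2 (fun hb => h2 ⟨ha, hb⟩) (by simp)
    · exact wt_lt_new hsub hm.1 ha (by simp)
  | or x a b χ h h1 h2 hχ =>
    have hx := mem_varsS_sat h
    have hm := hC.or_ _ _ (hI.mem_ _ _ h)
    have hd := hI.dep_ _ _ h
    simp only [GFormula.mdepth] at hd
    rcases hχ with rfl | rfl
    · exact ⟨d, hI.insert_sat hm.1 (by omega), Phi_lt (Finset.subset_insert _ _)
        (varsS_insert_sat hx _) hx (wt_lt_new (Finset.subset_insert _ _) hm.1 h1 (by simp))⟩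
    · exact ⟨d, hI.insert_sat hm.2 (by omega), Phi_lt (Finset.subset_insert _ _)
        (varsS_insert_sat hx _) hx (wt_lt_new (Finset.subset_insert _ _) hm.2 h2 (by simp))⟩
  | choose x r n ψ χ y h hr h1 h2 hχ =>
    have hy := (mem_varsS_rel hr).2
    have hdy := hI.rel_ _ _ _ hr
    have hm : (ψ ∈ C ∧ ψ.nnfNeg ∈ C) ∧ 1 + ψ.mdepth + d x ≤ D := by
      rcases h with h | h
      · exact ⟨hC.ge_ _ _ _ (hI.mem_ _ _ h), hI.dep_ _ _ h⟩
      · exact ⟨hC.le_ _ _ _ (hI.mem_ _ _ h), hI.dep_ _ _ h⟩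
    have hn := mdepth_nnfNeg ψ
    rcases hχ with rfl | rfl
    · exact ⟨d, hI.insert_sat hm.1.1 (by omega), Phi_lt (Finset.subset_insert _ _)
        (varsS_insert_sat hy _) hy (wt_lt_new (Finset.subset_insert _ _) hm.1.1 h1 (by simp))⟩
    · exact ⟨d, hI.insert_sat hm.1.2 (by omega), Phi_lt (Finset.subset_insert _ _)
        (varsS_insert_sat hy _) hy (wt_lt_new (Finset.subset_insert _ _) hm.1.2 h2 (by simp))⟩
  | ge x r n ψ y h hc hy =>
    have hx := mem_varsS_sat h
    have hyv : y ∉ varsS S := by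
      intro h'
      obtain ⟨c, hc, hyc⟩ := Finset.mem_biUnion.1 h'
      exact hy c hc hyc
    have hne : ∀ a ∈ varsS S, a ≠ y := fun a ha e => hyv (e ▸ ha)
    have hxy := hne x hx
    have hm := hC.ge_ _ _ _ (hI.mem_ _ _ h)
    have hd : 1 + ψ.mdepth + d x ≤ D := hI.dep_ _ _ h
    set S' := insert (Constraint.rel r x y) (insert (Constraint.sat y ψ) S) with hS'
    have hsub : S ⊆ S' := (Finset.subset_insert _ _).trans (Finset.subset_insert _ _)
    have hv : varsS S' = insert y (varsS S) := by
      unfold varsS at *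
      ext a
      simp only [hS', Finset.biUnion_insert, Constraint.vars, Finset.mem_union,
        Finset.mem_insert, Finset.mem_singleton]
      constructor
      · rintro ((rfl | rfl) | rfl | h) <;> simp_all
      · rintro (rfl | h) <;> simp_all
    have hcount : countS S r x ψ < countS S' r x ψ := by
      refine Set.ncard_lt_ncard ?_ (finite_count S' r x ψ)
      have hss : {b : ℕ | Constraint.rel r x b ∈ S ∧ Constraint.sat b ψ ∈ S} ⊆
          {b : ℕ | Constraint.rel r x b ∈ S' ∧ Constraint.sat b ψ ∈ S'} :=
        fun b hb => ⟨hsub hb.1, hsub hb.2⟩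
      refine (Set.ssubset_iff_of_subset hss).2 ⟨y, ?_, ?_⟩
      · simp [hS']
      · exact fun hb => hyv (mem_varsS_sat hb.2)
    have hw : wt C S' x < wt C S x := by
      refine wt_lt hsub (hI.mem_ _ _ h) ?_
      simp only [loc, credit]
      rw [if_pos h, if_pos (hsub h), if_pos h, if_pos (hsub h)]
      omega
    refine ⟨Function.update d y (d x + 1), ⟨?_, ?_, ?_⟩, ?_⟩
    · intro r' a b hab
      simp only [hS', Finset.mem_insert, Constraint.rel.injEq, reduceCtorEq, false_or] at hab
      rcases hab with ⟨rfl, rfl, rfl⟩ | hab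
      · rw [Function.update_self, Function.update_of_ne hxy]
      · have := mem_varsS_rel hab
        rw [Function.update_of_ne (hne _ this.1), Function.update_of_ne (hne _ this.2)]
        exact hI.rel_ _ _ _ hab
    · intro a χ ha
      simp only [hS', Finset.mem_insert, Constraint.sat.injEq, reduceCtorEq, false_or] at ha
      rcases ha with ⟨rfl, rfl⟩ | ha
      · exact hm.1
      · exact hI.mem_ _ _ ha
    · intro a χ ha
      simp only [hS', Finset.mem_insert, Constraint.sat.injEq, reduceCtorEq, false_or] at ha
      rcases ha with ⟨rfl, rfl⟩ | ha
      · rw [Function.update_self]; omega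
      · rw [Function.update_of_ne (hne _ (mem_varsS_sat ha))]
        exact hI.dep_ _ _ ha
    · unfold Phi
      rw [hv, Finset.sum_insert hyv, Function.update_self]
      have e1 : ∑ a ∈ varsS S, (wtBound C + 1) ^ (D - Function.update d y (d x + 1) a) * wt C S' a
          = ∑ a ∈ varsS S, (wtBound C + 1) ^ (D - d a) * wt C S' a := by
        apply Finset.sum_congr rfl
        intro a ha
        rw [Function.update_of_ne (hne a ha)]
      rw [e1, ← Finset.add_sum_erase _ _ hx, ← Finset.add_sum_erase (varsS S)
        (fun a => (wtBound C + 1) ^ (D - d a) * wt C S a) hx]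
      have e2 : ∑ a ∈ (varsS S).erase x, (wtBound C + 1) ^ (D - d a) * wt C S' a ≤
          ∑ a ∈ (varsS S).erase x, (wtBound C + 1) ^ (D - d a) * wt C S a :=
        Finset.sum_le_sum fun a _ => Nat.mul_le_mul_left _ (wt_mono hsub C a)
      obtain ⟨k, hk⟩ : ∃ k, D - d x = k + 1 := ⟨D - d x - 1, by omega⟩
      have hk' : D - (d x + 1) = k := by omega
      rw [hk, hk']
      have e3 : (wtBound C + 1) ^ (k + 1) * (wt C S' x + 1) ≤
          (wtBound C + 1) ^ (k + 1) * wt C S x := Nat.mul_le_mul_left _ hw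
      have e4 : (wtBound C + 1) ^ k * wt C S' y < (wtBound C + 1) ^ (k + 1) := by
        rw [pow_succ]
        exact Nat.mul_lt_mul_of_pos_left (Nat.lt_succ_of_le (wt_le C S' y)) (by positivity)
      rw [mul_add] at e3
      omega
  | le x r n ψ y z h hc hyz h1 h2 h3 h4 hsafe =>
    have hdyz : d y = d z := by rw [hI.rel_ _ _ _ h1, hI.rel_ _ _ _ h2]
    have hdσ : ∀ a, d (if a = y then z else a) = d a := by
      intro a; split
      · rename_i e; rw [e, hdyz]
      · rfl
    refine ⟨d, ⟨?_, ?_, ?_⟩, ?_⟩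
    · intro r' a b hab
      obtain ⟨c, hc, he⟩ := Finset.mem_image.1 hab
      cases c with
      | sat _ _ => simp [Constraint.rename] at he
      | rel r'' a' b' =>
        simp only [Constraint.rename, Constraint.rel.injEq] at he
        obtain ⟨rfl, rfl, rfl⟩ := he
        rw [hdσ, hdσ]; exact hI.rel_ _ _ _ hc
    · intro a χ ha
      obtain ⟨c, hc, he⟩ := Finset.mem_image.1 ha
      cases c with
      | rel _ _ _ => simp [Constraint.rename] at he
      | sat a' χ' =>
        simp only [Constraint.rename, Constraint.sat.injEq] at he
        obtain ⟨rfl, rfl⟩ := he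
        exact hI.mem_ _ _ hc
    · intro a χ ha
      obtain ⟨c, hc, he⟩ := Finset.mem_image.1 ha
      cases c with
      | rel _ _ _ => simp [Constraint.rename] at he
      | sat a' χ' =>
        simp only [Constraint.rename, Constraint.sat.injEq] at he
        obtain ⟨rfl, rfl⟩ := he
        rw [hdσ]; exact hI.dep_ _ _ hc
    · have hyv := (mem_varsS_rel h1).2
      have hzv := (mem_varsS_rel h2).2
      have hσ : ∀ a ∈ varsS S, (if a = y then z else a) ∈ (varsS S).erase y := by
        intro a ha
        split
        · exact Finset.mem_erase.2 ⟨hyz.symm, hzv⟩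
        · rename_i e; exact Finset.mem_erase.2 ⟨e, ha⟩
      have hv : varsS (renameCS S y z) ⊆ (varsS S).erase y := by
        intro a ha
        obtain ⟨c', hc', hac⟩ := Finset.mem_biUnion.1 ha
        obtain ⟨c, hc, rfl⟩ := Finset.mem_image.1 hc'
        cases c with
        | sat b χ =>
          simp only [Constraint.rename, Constraint.vars, Finset.mem_singleton] at hac
          rw [hac]; exact hσ _ (mem_varsS_sat hc)
        | rel r' b b' =>
          simp only [Constraint.rename, Constraint.vars, Finset.mem_singleton,
            Finset.mem_insert] at hac
          rcases hac with hac | hac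
          · rw [hac]; exact hσ _ (mem_varsS_rel hc).1
          · rw [hac]; exact hσ _ (mem_varsS_rel hc).2
      unfold Phi
      calc _ ≤ ∑ a ∈ (varsS S).erase y, (wtBound C + 1) ^ (D - d a) * wt C (renameCS S y z) a :=
            Finset.sum_le_sum_of_subset hv
        _ ≤ ∑ a ∈ (varsS S).erase y, (wtBound C + 1) ^ (D - d a) * wt C S a := by
            refine Finset.sum_le_sum fun a ha => Nat.mul_le_mul_left _ ?_
            have hay := (Finset.mem_erase.1 ha).1
            unfold wt
            gcongr with ξ hξ
            refine loc_mono_of ?_ ?_ ξ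
            · intro χ hχ
              have := Finset.mem_image_of_mem (Constraint.rename y z) hχ
              simpa only [renameCS, Constraint.rename, if_neg hay] using this
            · intro r n ψ hg
              exact rename_count hsafe hay hg
        _ < _ := by
            rw [← Finset.add_sum_erase _ _ hyv]
            have : 0 < (wtBound C + 1) ^ (D - d y) * wt C S y := by
              have : 0 < wt C S y := by unfold wt; omega
              positivity
            omega

theorem no_infinite {C : Finset GFormula} (hC : Closed C) {D : ℕ} (m : ℕ) :
    ∀ (d : ℕ → ℕ) (f : ℕ → Finset Constraint), TInv C D d (f 0) → Phi C D d (f 0) ≤ m →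
      ¬ ∀ n, StdStep (f n) (f (n + 1)) := by
  induction m with
  | zero =>
    intro d f hI hm hf
    obtain ⟨d', _, h⟩ := step_decreases hC hI (hf 0)
    omega
  | succ m ih =>
    intro d f hI hm hf
    obtain ⟨d', hI', h⟩ := step_decreases hC hI (hf 0)
    exact ih d' (fun n => f (n + 1)) hI' (by omega) fun n => hf (n + 1)

theorem exists_complete {C : Finset GFormula} (hC : Closed C) {D : ℕ} (m : ℕ) :
    ∀ (d : ℕ → ℕ) (S : Finset Constraint), TInv C D d S → Phi C D d S ≤ m → csSat S →
      ∃ S', Relation.ReflTransGen StdStep S S' ∧ StdComplete S' ∧ ¬ hasClash S' := by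
  induction m with
  | zero =>
    intro d S hI hm hS
    by_cases hc : StdComplete S
    · exact ⟨S, .refl, hc, csSat_no_clash hS⟩
    · obtain ⟨S', hs, _⟩ := csSat_progress hS hc
      obtain ⟨d', _, h⟩ := step_decreases hC hI hs
      omega
  | succ m ih =>
    intro d S hI hm hS
    by_cases hc : StdComplete S
    · exact ⟨S, .refl, hc, csSat_no_clash hS⟩
    · obtain ⟨S', hs, hS'⟩ := csSat_progress hS hc
      obtain ⟨d', hI', h⟩ := step_decreases hC hI hs
      obtain ⟨T, h1, h2⟩ := ih d' S' hI' (by omega) hS'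
      exact ⟨T, h1.head hs, h2⟩

theorem TInv_init {C : Finset GFormula} {φ : GFormula} (h : φ ∈ C) (x₀ : ℕ) :
    TInv C φ.mdepth (fun _ => 0) (initCS x₀ φ) := by
  refine ⟨?_, ?_, ?_⟩
  · intro r x y h; simp [initCS] at h
  · intro x ψ hx
    simp only [initCS, Finset.mem_singleton, Constraint.sat.injEq] at hx
    rw [hx.2]; exact h
  · intro x ψ hx
    simp only [initCS, Finset.mem_singleton, Constraint.sat.injEq] at hx
    rw [hx.2]; simp

end GrK

open GrK in
/-- correctness of the standard (Hollunder–Baader) algorithm: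
φ (in NNF) is satisfiable iff {x₀ ⊨ φ} can be transformed into a complete and
clash-free c.s. by the standard completion rules; moreover every sequence of
applications of these rules is finite. -/
theorem stmt_15 (φ : GFormula) (hNNF : φ.isNNF) (x₀ : ℕ) :
    (φ.satisfiable ↔ ∃ S, StdReach x₀ φ S ∧ StdComplete S ∧ ¬ hasClash S) ∧
    ¬ ∃ f : ℕ → Finset Constraint,
        f 0 = initCS x₀ φ ∧ ∀ n, StdStep (f n) (f (n + 1)) := by
  obtain ⟨C, hC, hφ, -⟩ := exists_closed φ
  have hI := TInv_init hφ x₀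
  refine ⟨⟨?_, ?_⟩, ?_⟩
  · rintro ⟨M, w, hw⟩
    refine exists_complete hC _ _ _ hI le_rfl ⟨M, fun _ => w, ?_, ?_, ?_⟩
    · intro r x y z h; simp [initCS] at h
    · intro x ψ hx
      simp only [initCS, Finset.mem_singleton, Constraint.sat.injEq] at hx
      rw [hx.2]; exact hw
    · intro r x y h; simp [initCS] at h
  · rintro ⟨S, hR, hc, hcl⟩
    obtain ⟨x, hx⟩ := reach_mem hR
    exact ⟨canonical S, x, (sound_aux S hc hcl φ hNNF x).1 hx⟩
  · rintro ⟨f, h0, hf⟩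
    exact no_infinite hC _ _ f (h0 ▸ hI) le_rfl hf
end

section
/- Termination of the Gr(K_{R⁻¹∩})-algorithm: any sequence of applications of the Gr(K_{R⁻¹∩}) completion rules starting from the constraint system {x₀ ⊨ φ}, for a Gr(K_{R⁻¹∩})-formula φ in NNF, is finite. -/
/-! Core definitions for Gr(K_{R⁻¹∩}): relations with inverses,
intersections of relations, formulae, semantics, constraint systems with
the ≺ bookkeeping relation, and the Gr(K_{R⁻¹∩}) completion rules. -/

namespace GrK

/-- A Gr(K_{R⁻¹∩})-relation: a relation name or the inverse of one. -/
inductive GRel : Type where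
  | name : ℕ → GRel
  | inv : ℕ → GRel
  deriving DecidableEq

/-- The inverse of a Gr(K_{R⁻¹∩})-relation, with (R⁻¹)⁻¹ = R. -/
def GRel.inverse : GRel → GRel
  | .name r => .inv r
  | .inv r => .name r

/-- A (nonempty) intersection ω = R₁ ∩ … ∩ R_k of Gr(K_{R⁻¹∩})-relations. -/
abbrev RelInter := {ω : Finset GRel // ω.Nonempty}

/-- Gr(K_{R⁻¹∩})-formulae: graded modalities over intersections of
(possibly inverse) relations. -/
inductive GIFormula : Type where
  | atom : ℕ → GIFormula
  | neg  : GIFormula → GIFormula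
  | and  : GIFormula → GIFormula → GIFormula
  | or   : GIFormula → GIFormula → GIFormula
  | ge   : RelInter → ℕ → GIFormula → GIFormula
  | le   : RelInter → ℕ → GIFormula → GIFormula

noncomputable instance : DecidableEq GIFormula := Classical.decEq _

/-- Interpretation of a (possibly inverse) relation in a Kripke structure. -/
def GRel.interp (M : Kripke) : GRel → M.W → M.W → Prop
  | .name r => M.rel r
  | .inv r => fun x y => M.rel r y x

/-- Satisfaction for Gr(K_{R⁻¹∩}): ⟨ω⟩_{≥n}/⟨ω⟩_{≤n} count the
⋂_{R∈ω}R-successors satisfying the formula. -/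
def GIFormula.sat (M : Kripke) : GIFormula → M.W → Prop
  | .atom p, x => x ∈ M.val p
  | .neg φ, x => ¬ GIFormula.sat M φ x
  | .and φ ψ, x => GIFormula.sat M φ x ∧ GIFormula.sat M ψ x
  | .or φ ψ, x => GIFormula.sat M φ x ∨ GIFormula.sat M ψ x
  | .ge ω n φ, x => (n : Cardinal) ≤
      Cardinal.mk {y : M.W // (∀ R ∈ ω.1, GRel.interp M R x y) ∧ GIFormula.sat M φ y}
  | .le ω n φ, x =>
      Cardinal.mk {y : M.W // (∀ R ∈ ω.1, GRel.interp M R x y) ∧ GIFormula.sat M φ y} ≤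
        (n : Cardinal)

/-- Satisfiability of a Gr(K_{R⁻¹∩})-formula. -/
def GIFormula.satisfiable (φ : GIFormula) : Prop :=
  ∃ (M : Kripke) (x : M.W), GIFormula.sat M φ x

/-- Negation normal form for Gr(K_{R⁻¹∩}). -/
def GIFormula.isNNF : GIFormula → Prop
  | .atom _ => True
  | .neg (.atom _) => True
  | .neg _ => False
  | .and φ ψ => GIFormula.isNNF φ ∧ GIFormula.isNNF ψ
  | .or φ ψ => GIFormula.isNNF φ ∧ GIFormula.isNNF ψ
  | .ge _ _ φ => GIFormula.isNNF φ
  | .le _ _ φ => GIFormula.isNNF φ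

/-- ~φ for Gr(K_{R⁻¹∩})-formulae in NNF. -/
def GIFormula.nnfNeg : GIFormula → GIFormula
  | .atom p => .neg (.atom p)
  | .neg φ => φ
  | .and φ ψ => .or φ.nnfNeg ψ.nnfNeg
  | .or φ ψ => .and φ.nnfNeg ψ.nnfNeg
  | .ge ω n φ => if n = 0 then .and (.atom 0) (.neg (.atom 0)) else .le ω (n - 1) φ
  | .le ω n φ => .ge ω (n + 1) φ

/-- Constraints for Gr(K_{R⁻¹∩}): `x ⊨ ψ` or `R x y` for a
(possibly inverse) relation R. -/
inductive IConstraint : Type where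
  | sat : ℕ → GIFormula → IConstraint
  | rel : GRel → ℕ → ℕ → IConstraint

noncomputable instance : DecidableEq IConstraint := Classical.decEq _

/-- Variables occurring in a constraint. -/
def IConstraint.vars : IConstraint → Finset ℕ
  | .sat x _ => {x}
  | .rel _ x y => {x, y}

/-- ♯ω^S(x,ψ): the number of variables y with Rxy ∈ S for all R ∈ ω
and y ⊨ ψ ∈ S. -/
noncomputable def countI (S : Finset IConstraint) (ω : RelInter) (x : ℕ) (ψ : GIFormula) : ℕ :=
  Set.ncard {y : ℕ | (∀ R ∈ ω.1, IConstraint.rel R x y ∈ S) ∧ IConstraint.sat y ψ ∈ S}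

/-- A clash for Gr(K_{R⁻¹∩}). -/
def hasClashI (S : Finset IConstraint) : Prop :=
  (∃ x p, IConstraint.sat x (.atom p) ∈ S ∧ IConstraint.sat x (.neg (.atom p)) ∈ S) ∨
  (∃ x ω n ψ, IConstraint.sat x (.le ω n ψ) ∈ S ∧ n < countI S ω x ψ)

/-- The state of the Gr(K_{R⁻¹∩})-algorithm: a constraint system together with
the bookkeeping relation ≺ (x ≺ y iff y was created by the →≥-rule for x). -/
structure IState where
  cs : Finset IConstraint
  prec : Finset (ℕ × ℕ)

/-- The relation ≺ given by the bookkeeping finset. -/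
def precRel (P : Finset (ℕ × ℕ)) : ℕ → ℕ → Prop := fun a b => (a, b) ∈ P

/-- The →∧-rule applies to a constraint for x. -/
def iAndApplicable (S : Finset IConstraint) (x : ℕ) : Prop :=
  ∃ ψ₁ ψ₂, IConstraint.sat x (.and ψ₁ ψ₂) ∈ S ∧
    ¬ (IConstraint.sat x ψ₁ ∈ S ∧ IConstraint.sat x ψ₂ ∈ S)

/-- The →∨-rule applies to a constraint for x. -/
def iOrApplicable (S : Finset IConstraint) (x : ℕ) : Prop :=
  ∃ ψ₁ ψ₂, IConstraint.sat x (.or ψ₁ ψ₂) ∈ S ∧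
    IConstraint.sat x ψ₁ ∉ S ∧ IConstraint.sat x ψ₂ ∉ S

/-- The →choose-rule applies to a constraint for x. -/
def iChooseApplicable (S : Finset IConstraint) (x : ℕ) : Prop :=
  ∃ ω n ψ y, (IConstraint.sat x (.ge ω n ψ) ∈ S ∨ IConstraint.sat x (.le ω n ψ) ∈ S) ∧
    (∃ R ∈ ω.1, IConstraint.rel R x y ∈ S) ∧
    IConstraint.sat y ψ ∉ S ∧ IConstraint.sat y ψ.nnfNeg ∉ S

/-- One application of a Gr(K_{R⁻¹∩}) completion rule. -/
inductive IStep : IState → IState → Prop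
  | and (st : IState) (x : ℕ) (ψ₁ ψ₂ : GIFormula)
      (h : IConstraint.sat x (.and ψ₁ ψ₂) ∈ st.cs)
      (h2 : ¬ (IConstraint.sat x ψ₁ ∈ st.cs ∧ IConstraint.sat x ψ₂ ∈ st.cs)) :
      IStep st ⟨insert (IConstraint.sat x ψ₁) (insert (IConstraint.sat x ψ₂) st.cs), st.prec⟩
  | or (st : IState) (x : ℕ) (ψ₁ ψ₂ χ : GIFormula)
      (h : IConstraint.sat x (.or ψ₁ ψ₂) ∈ st.cs)
      (h1 : IConstraint.sat x ψ₁ ∉ st.cs) (h2 : IConstraint.sat x ψ₂ ∉ st.cs)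
      (hχ : χ = ψ₁ ∨ χ = ψ₂) :
      IStep st ⟨insert (IConstraint.sat x χ) st.cs, st.prec⟩
  | choose (st : IState) (S' : Finset IConstraint) (P' : Finset (ℕ × ℕ))
      (x : ℕ) (ω : RelInter) (n : ℕ) (ψ χ : GIFormula) (y : ℕ)
      (h : IConstraint.sat x (.ge ω n ψ) ∈ st.cs ∨ IConstraint.sat x (.le ω n ψ) ∈ st.cs)
      (hr : ∃ R ∈ ω.1, IConstraint.rel R x y ∈ st.cs)
      (h1 : IConstraint.sat y ψ ∉ st.cs) (h2 : IConstraint.sat y ψ.nnfNeg ∉ st.cs)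
      (hχ : χ = ψ ∨ χ = ψ.nnfNeg)
      (hS' : (S' : Set IConstraint) =
        {c | c ∈ st.cs ∧ ∀ z ∈ c.vars, ¬ Relation.TransGen (precRel st.prec) y z} ∪
          {IConstraint.sat y χ})
      (hP' : (P' : Set (ℕ × ℕ)) =
        {p | p ∈ st.prec ∧ ¬ Relation.TransGen (precRel st.prec) y p.1 ∧
             ¬ Relation.TransGen (precRel st.prec) y p.2}) :
      IStep st ⟨S', P'⟩
  | ge (st : IState) (S' : Finset IConstraint) (x : ℕ) (ω : RelInter) (n : ℕ)
      (ψ : GIFormula) (y : ℕ) (ρ : Finset GRel) (f : GIFormula → GIFormula)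
      (h : IConstraint.sat x (.ge ω n ψ) ∈ st.cs)
      (hc : countI st.cs ω x ψ < n)
      (hng : ¬ iAndApplicable st.cs x ∧ ¬ iOrApplicable st.cs x ∧ ¬ iChooseApplicable st.cs x)
      (hfresh : (∀ c ∈ st.cs, y ∉ c.vars) ∧ ∀ p ∈ st.prec, y ≠ p.1 ∧ y ≠ p.2)
      (hρ : ω.1 ⊆ ρ)
      (hf : ∀ ψ', f ψ' = ψ' ∨ f ψ' = ψ'.nnfNeg)
      (hS' : (S' : Set IConstraint) = (st.cs : Set IConstraint) ∪ {IConstraint.sat y ψ} ∪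
          {c | ∃ ψ' σ m,
            (IConstraint.sat x (.ge σ m ψ') ∈ st.cs ∨ IConstraint.sat x (.le σ m ψ') ∈ st.cs) ∧
            c = IConstraint.sat y (f ψ')} ∪
          {c | ∃ R ∈ ρ, c = IConstraint.rel R x y ∨ c = IConstraint.rel R.inverse y x}) :
      IStep st ⟨S', insert (x, y) st.prec⟩

/-- The initial state ({x₀ ⊨ φ}, ∅). -/
def initI (x₀ : ℕ) (φ : GIFormula) : IState := ⟨{IConstraint.sat x₀ φ}, ∅⟩

/-- st is obtained from ({x₀ ⊨ φ}, ∅) by a sequence of rule applications. -/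
def IReach (x₀ : ℕ) (φ : GIFormula) (st : IState) : Prop :=
  Relation.ReflTransGen IStep (initI x₀ φ) st

/-- A state is complete iff no Gr(K_{R⁻¹∩})-rule is applicable. -/
def ICompleteState (st : IState) : Prop := ¬ ∃ st', IStep st st'

/-- The canonical structure induced by a Gr(K_{R⁻¹∩}) constraint system. -/
def canonicalI (S : Finset IConstraint) : Kripke where
  W := ℕ
  nonempty := ⟨0⟩
  rel := fun r x y => IConstraint.rel (GRel.name r) x y ∈ S
  val := fun p => {x | IConstraint.sat x (.atom p) ∈ S}

/-- The inclusion of Gr(K_R)-formulae into Gr(K_{R⁻¹∩})-formulae. -/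
def GFormula.toGI : GFormula → GIFormula
  | .atom p => .atom p
  | .neg φ => .neg φ.toGI
  | .and φ ψ => .and φ.toGI ψ.toGI
  | .or φ ψ => .or φ.toGI ψ.toGI
  | .ge r n φ => .ge ⟨{GRel.name r}, Finset.singleton_nonempty _⟩ n φ.toGI
  | .le r n φ => .le ⟨{GRel.name r}, Finset.singleton_nonempty _⟩ n φ.toGI

end GrK

namespace GrK

/-- Modal depth. -/
def GIFormula.md : GIFormula → ℕ
  | .atom _ => 0
  | .neg φ => φ.md
  | .and φ ψ => max φ.md ψ.md
  | .or φ ψ => max φ.md ψ.md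
  | .ge _ _ φ => φ.md + 1
  | .le _ _ φ => φ.md + 1

theorem md_nnfNeg (φ : GIFormula) : φ.nnfNeg.md ≤ φ.md := by
  induction φ with
  | atom p => simp [GIFormula.nnfNeg, GIFormula.md]
  | neg φ ih => simp [GIFormula.nnfNeg, GIFormula.md]
  | and a b iha ihb => simp only [GIFormula.nnfNeg, GIFormula.md]; omega
  | or a b iha ihb => simp only [GIFormula.nnfNeg, GIFormula.md]; omega
  | ge ω n a ih =>
    simp only [GIFormula.nnfNeg]
    split <;> simp [GIFormula.md]
  | le ω n a ih => simp [GIFormula.nnfNeg, GIFormula.md]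

/-- Closed sets of formulae. -/
structure FClosed (C : Finset GIFormula) : Prop where
  and : ∀ a b, GIFormula.and a b ∈ C → a ∈ C ∧ b ∈ C
  or : ∀ a b, GIFormula.or a b ∈ C → a ∈ C ∧ b ∈ C
  ge : ∀ ω n a, GIFormula.ge ω n a ∈ C → a ∈ C
  le : ∀ ω n a, GIFormula.le ω n a ∈ C → a ∈ C
  nn : ∀ a, a ∈ C → a.nnfNeg ∈ C

theorem closed_atom (p : ℕ) :
    FClosed ({.atom p, .neg (.atom p)} : Finset GIFormula) := by
  constructor <;> simp [GIFormula.nnfNeg]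

theorem closed_bin {A B : Finset GIFormula} (hA : FClosed A) (hB : FClosed B) :
    FClosed (A ∪ B ∪ (A ×ˢ B).image (fun p => GIFormula.and p.1 p.2) ∪
      (A ×ˢ B).image (fun p => GIFormula.or p.1 p.2)) := by
  constructor
  · intro a b h
    simp at h ⊢
    have h1 := hA.and a b
    have h2 := hB.and a b
    tauto
  · intro a b h
    simp at h ⊢
    have h1 := hA.or a b
    have h2 := hB.or a b
    tauto
  · intro ω n a h
    simp at h ⊢
    rcases h with h | h
    · have := hA.ge _ _ _ h; tauto
    · have := hB.ge _ _ _ h; tauto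
  · intro ω n a h
    simp at h ⊢
    rcases h with h | h
    · have := hA.le _ _ _ h; tauto
    · have := hB.le _ _ _ h; tauto
  · intro a h
    simp only [Finset.mem_union, Finset.mem_image, Finset.mem_product, Prod.exists] at h ⊢
    rcases h with ((h | h) | ⟨u, v, ⟨hu, hv⟩, rfl⟩) | ⟨u, v, ⟨hu, hv⟩, rfl⟩
    · exact Or.inl (Or.inl (Or.inl (hA.nn _ h)))
    · exact Or.inl (Or.inl (Or.inr (hB.nn _ h)))
    · exact Or.inr ⟨_, _, ⟨hA.nn _ hu, hB.nn _ hv⟩, rfl⟩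
    · exact Or.inl (Or.inr ⟨_, _, ⟨hA.nn _ hu, hB.nn _ hv⟩, rfl⟩)

theorem closed_mod {A : Finset GIFormula} (hA : FClosed A) (ω : RelInter) (n : ℕ)
    (φ : GIFormula) (hφ : φ ∈ A) :
    FClosed (A ∪ (Finset.range (n+2)).image (fun m => GIFormula.ge ω m φ) ∪
      (Finset.range (n+1)).image (fun m => GIFormula.le ω m φ) ∪
      {.atom 0, .neg (.atom 0), .and (.atom 0) (.neg (.atom 0)),
        .or (.neg (.atom 0)) (.atom 0)}) := by
  constructor
  · intro a b h
    simp at h ⊢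
    rcases h with h | h
    · simp [h]
    · have := hA.and _ _ h; tauto
  · intro a b h
    simp at h ⊢
    rcases h with h | h
    · simp [h]
    · have := hA.or _ _ h; tauto
  · intro σ m a h
    simp at h ⊢
    rcases h with h | h
    · have := hA.ge _ _ _ h; tauto
    · simp [← h.2.2, hφ]
  · intro σ m a h
    simp at h ⊢
    rcases h with h | h
    · have := hA.le _ _ _ h; tauto
    · simp [← h.2.2, hφ]
  · intro a h
    simp only [Finset.mem_union, Finset.mem_image, Finset.mem_range, Finset.mem_insert,
      Finset.mem_singleton] at h ⊢
    rcases h with ((h | ⟨m, hm, rfl⟩) | ⟨m, hm, rfl⟩) | h | h | h | h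
    · exact Or.inl (Or.inl (Or.inl (hA.nn _ h)))
    · simp only [GIFormula.nnfNeg]
      split
      · simp
      · exact Or.inl (Or.inr ⟨m - 1, by omega, rfl⟩)
    · exact Or.inl (Or.inl (Or.inr ⟨m + 1, by omega, rfl⟩))
    all_goals subst h; simp [GIFormula.nnfNeg]

theorem exists_closed_s16 (φ : GIFormula) (h : φ.isNNF) :
    ∃ C : Finset GIFormula, φ ∈ C ∧ FClosed C := by
  induction φ with
  | atom p => exact ⟨_, by simp, closed_atom p⟩
  | neg φ ih =>
    cases φ with
    | atom p => exact ⟨_, by simp, closed_atom p⟩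
    | _ => simp [GIFormula.isNNF] at h
  | and a b iha ihb =>
    obtain ⟨A, ha, hA⟩ := iha h.1
    obtain ⟨B, hb, hB⟩ := ihb h.2
    exact ⟨_, by simp [ha, hb], closed_bin hA hB⟩
  | or a b iha ihb =>
    obtain ⟨A, ha, hA⟩ := iha h.1
    obtain ⟨B, hb, hB⟩ := ihb h.2
    exact ⟨_, by simp [ha, hb], closed_bin hA hB⟩
  | ge ω n a ih =>
    obtain ⟨A, ha, hA⟩ := ih h
    exact ⟨_, by simp, closed_mod hA ω n a ha⟩
  | le ω n a ih =>
    obtain ⟨A, ha, hA⟩ := ih h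
    exact ⟨_, by simp, closed_mod hA ω n a ha⟩

/-- The variables of a c.s. -/
noncomputable def csV (S : Finset IConstraint) : Finset ℕ := S.biUnion IConstraint.vars

theorem mem_csV {S : Finset IConstraint} {c : IConstraint} {z : ℕ} (hc : c ∈ S)
    (hz : z ∈ c.vars) : z ∈ csV S := Finset.mem_biUnion.2 ⟨c, hc, hz⟩

/-- Number of missing labels of x. -/
noncomputable def missL (C : Finset GIFormula) (S : Finset IConstraint) (x : ℕ) : ℕ :=
  (C.filter (fun ψ => IConstraint.sat x ψ ∉ S)).card

/-- Deficiency of a formula at x. -/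
noncomputable def defi (S : Finset IConstraint) (x : ℕ) : GIFormula → ℕ
  | .ge ω n ψ => n - countI S ω x ψ
  | _ => 0

/-- The lexicographic measure. -/
noncomputable def meas (C : Finset GIFormula) (S : Finset IConstraint) (dep : ℕ → ℕ)
    (i : ℕ) : ℕ :=
  if i % 2 = 0 then ∑ x ∈ (csV S).filter (fun x => dep x = i / 2), missL C S x
  else ∑ x ∈ (csV S).filter (fun x => dep x = i / 2), ∑ ψ ∈ C, defi S x ψ

/-- Strict lexicographic decrease below K. -/
def Dec (K : ℕ) (m m' : ℕ → ℕ) : Prop :=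
  ∃ i < K, m' i < m i ∧ ∀ j < i, m' j ≤ m j

theorem no_inf_dec (K : ℕ) (m : ℕ → ℕ → ℕ) (h : ∀ t, Dec K (m t) (m (t+1))) : False := by
  choose i hiK hlt hle using h
  have key : ∀ k, ∃ N, ∀ t ≥ N, k ≤ i t := by
    intro k
    induction k with
    | zero => exact ⟨0, fun _ _ => Nat.zero_le _⟩
    | succ k ih =>
      obtain ⟨N, hN⟩ := ih
      by_contra hcon
      push Not at hcon
      have hmono : ∀ t ≥ N, m (t+1) k ≤ m t k := by
        intro t ht
        rcases (hN t ht).lt_or_eq with h | h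
        · exact hle t k h
        · have := hlt t; rw [← h] at this; exact this.le
      have hmono2 : ∀ t ≥ N, ∀ s, m (t+s) k ≤ m t k := by
        intro t ht s
        induction s with
        | zero => exact le_rfl
        | succ s ihs => exact (hmono (t+s) (by omega)).trans ihs
      have : ∀ v, ∀ t ≥ N, m t k = v → False := by
        intro v
        induction v using Nat.strong_induction_on with
        | _ v ihv =>
          intro t ht hv
          obtain ⟨s, hs, hsk⟩ := hcon t
          have e : i s = k := by have := hN s (by omega); omega
          have h1 := hlt s
          rw [e] at h1
          have h2 := hmono2 t ht (s - t)
          rw [show t + (s - t) = s by omega] at h2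
          exact ihv (m (s+1) k) (by omega) (s+1) (by omega) rfl
      exact this _ N le_rfl rfl
  obtain ⟨N, hN⟩ := key K
  have := hN N le_rfl
  have := hiK N
  omega

theorem countI_fin (S : Finset IConstraint) (ω : RelInter) (x : ℕ) (ψ : GIFormula) :
    {y : ℕ | (∀ R ∈ ω.1, IConstraint.rel R x y ∈ S) ∧ IConstraint.sat y ψ ∈ S}.Finite := by
  apply (csV S).finite_toSet.subset
  intro y hy
  exact mem_csV hy.2 (by simp [IConstraint.vars])

theorem missL_mono {C : Finset GIFormula} {S S' : Finset IConstraint} {x : ℕ}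
    (h : ∀ ψ, IConstraint.sat x ψ ∈ S → IConstraint.sat x ψ ∈ S') :
    missL C S' x ≤ missL C S x := by
  apply Finset.card_le_card
  intro ψ hψ
  simp only [Finset.mem_filter] at hψ ⊢
  exact ⟨hψ.1, fun h' => hψ.2 (h _ h')⟩

theorem missL_strict {C : Finset GIFormula} {S S' : Finset IConstraint} {x : ℕ}
    (h : ∀ ψ, IConstraint.sat x ψ ∈ S → IConstraint.sat x ψ ∈ S') {χ : GIFormula}
    (hχ : χ ∈ C) (h1 : IConstraint.sat x χ ∉ S) (h2 : IConstraint.sat x χ ∈ S') :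
    missL C S' x < missL C S x := by
  apply Finset.card_lt_card
  refine ⟨?_, ?_⟩
  · intro ψ hψ
    simp only [Finset.mem_filter] at hψ ⊢
    exact ⟨hψ.1, fun h' => hψ.2 (h _ h')⟩
  · intro hs
    have := hs (Finset.mem_filter.2 ⟨hχ, h1⟩)
    exact (Finset.mem_filter.1 this).2 h2

theorem defi_mono {S S' : Finset IConstraint} {x : ℕ}
    (h : ∀ R y ψ, IConstraint.rel R x y ∈ S → IConstraint.sat y ψ ∈ S →
      IConstraint.rel R x y ∈ S' ∧ IConstraint.sat y ψ ∈ S') (ψ : GIFormula) :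
    defi S' x ψ ≤ defi S x ψ := by
  cases ψ with
  | ge ω n ψ =>
    simp only [defi]
    apply Nat.sub_le_sub_left
    apply Set.ncard_le_ncard _ (countI_fin S' ω x ψ)
    rintro y ⟨hy1, hy2⟩
    obtain ⟨R, hR⟩ := ω.2
    exact ⟨fun R hR => (h R y ψ (hy1 R hR) hy2).1, (h R y ψ (hy1 R hR) hy2).2⟩
  | _ => simp [defi]

theorem dec_label {C : Finset GIFormula} {S S' : Finset IConstraint} {dep : ℕ → ℕ} {D d : ℕ}
    (hd : d ≤ D) (hV : csV S' ⊆ csV S)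
    (hk : ∀ c ∈ S, (∀ z ∈ c.vars, dep z ≤ d) → c ∈ S')
    (hrel : ∀ R x y, IConstraint.rel R x y ∈ S → dep y = dep x + 1 ∨ dep x = dep y + 1)
    {y : ℕ} (hy : y ∈ csV S) (hyd : dep y = d) {χ : GIFormula} (hχ : χ ∈ C)
    (h1 : IConstraint.sat y χ ∉ S) (h2 : IConstraint.sat y χ ∈ S') :
    Dec (2*D+2) (meas C S dep) (meas C S' dep) := by
  have hsat : ∀ x, dep x ≤ d → ∀ ψ, IConstraint.sat x ψ ∈ S → IConstraint.sat x ψ ∈ S' := by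
    intro x hx ψ h
    exact hk _ h (by simpa [IConstraint.vars] using hx)
  refine ⟨2*d, by omega, ?_, ?_⟩
  · simp only [meas, show 2*d%2 = 0 by omega, if_true, show 2*d/2 = d by omega]
    calc _ ≤ ∑ x ∈ (csV S).filter (fun x => dep x = d), missL C S' x :=
          Finset.sum_le_sum_of_subset (Finset.filter_subset_filter _ hV)
      _ < _ := by
        apply Finset.sum_lt_sum
        · intro x hx
          exact missL_mono (hsat x (Finset.mem_filter.1 hx).2.le)
        · exact ⟨y, Finset.mem_filter.2 ⟨hy, hyd⟩, missL_strict (hsat y hyd.le) hχ h1 h2⟩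
  · intro j hj
    simp only [meas]
    split
    · refine (Finset.sum_le_sum_of_subset (Finset.filter_subset_filter _ hV)).trans ?_
      apply Finset.sum_le_sum
      intro x hx
      have := (Finset.mem_filter.1 hx).2
      exact missL_mono (hsat x (by omega))
    · refine (Finset.sum_le_sum_of_subset (Finset.filter_subset_filter _ hV)).trans ?_
      apply Finset.sum_le_sum
      intro x hx
      have hx := (Finset.mem_filter.1 hx).2
      apply Finset.sum_le_sum
      intro ψ _
      apply defi_mono
      intro R z ψ hR hs
      have := hrel _ _ _ hR
      refine ⟨hk _ hR ?_, hsat z (by omega) _ hs⟩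
      simp only [IConstraint.vars, Finset.mem_insert, Finset.mem_singleton]
      rintro w (rfl | rfl) <;> omega

theorem dec_ge {C : Finset GIFormula} {S S' : Finset IConstraint} {dep dep' : ℕ → ℕ} {D d : ℕ}
    (hd : d ≤ D) {y : ℕ} (hV : csV S' ⊆ insert y (csV S)) (hyd : dep' y = d + 1)
    (hdep : ∀ z ∈ csV S, dep' z = dep z)
    (hk : S ⊆ S') {x : ℕ} (hx : x ∈ csV S) (hxd : dep x = d) {ω : RelInter} {n : ℕ}
    {ψ : GIFormula} (hC : GIFormula.ge ω n ψ ∈ C) (hc : countI S ω x ψ < n)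
    (hyV : y ∉ csV S) (hyR : ∀ R ∈ ω.1, IConstraint.rel R x y ∈ S')
    (hyψ : IConstraint.sat y ψ ∈ S') :
    Dec (2*D+2) (meas C S dep) (meas C S' dep') := by
  have hsub : ∀ j ≤ d, (csV S').filter (fun x => dep' x = j) ⊆
      (csV S).filter (fun x => dep x = j) := by
    intro j hj z hz
    obtain ⟨hz, hzj⟩ := Finset.mem_filter.1 hz
    rcases Finset.mem_insert.1 (hV hz) with rfl | hz
    · omega
    · exact Finset.mem_filter.2 ⟨hz, by rw [← hdep z hz, hzj]⟩
  have hdm : ∀ z ψ, defi S' z ψ ≤ defi S z ψ := fun z ψ =>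
    defi_mono (fun R y ψ h1 h2 => ⟨hk h1, hk h2⟩) ψ
  refine ⟨2*d+1, by omega, ?_, ?_⟩
  · simp only [meas, show ¬ ((2*d+1)%2 = 0) by omega, if_false, show (2*d+1)/2 = d by omega]
    refine (Finset.sum_le_sum_of_subset (hsub d le_rfl)).trans_lt ?_
    apply Finset.sum_lt_sum
    · intro z _
      exact Finset.sum_le_sum (fun ψ _ => hdm z ψ)
    · refine ⟨x, Finset.mem_filter.2 ⟨hx, hxd⟩, ?_⟩
      apply Finset.sum_lt_sum (fun ψ _ => hdm x ψ)
      refine ⟨_, hC, ?_⟩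
      have : countI S ω x ψ < countI S' ω x ψ := by
        apply Set.ncard_lt_ncard _ (countI_fin S' ω x ψ)
        refine ⟨fun z hz => ⟨fun R hR => hk (hz.1 R hR), hk hz.2⟩, fun hs => ?_⟩
        have := hs (show y ∈ _ from ⟨hyR, hyψ⟩)
        exact hyV (mem_csV this.2 (by simp [IConstraint.vars]))
      simp only [defi]
      omega
  · intro j hj
    simp only [meas]
    split
    · refine (Finset.sum_le_sum_of_subset (hsub _ (by omega))).trans ?_
      apply Finset.sum_le_sum
      intro z _
      exact missL_mono (fun ψ h => hk h)
    · refine (Finset.sum_le_sum_of_subset (hsub _ (by omega))).trans ?_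
      apply Finset.sum_le_sum
      intro z _
      exact Finset.sum_le_sum (fun ψ _ => hdm z ψ)

/-- The invariant. -/
structure Inv (C : Finset GIFormula) (D : ℕ) (st : IState) (dep : ℕ → ℕ) : Prop where
  sat : ∀ x ψ, IConstraint.sat x ψ ∈ st.cs → ψ ∈ C ∧ ψ.md + dep x ≤ D
  rel : ∀ R x y, IConstraint.rel R x y ∈ st.cs → dep y = dep x + 1 ∨ dep x = dep y + 1
  prec : ∀ x y, (x, y) ∈ st.prec → dep y = dep x + 1

theorem Inv.desc {C : Finset GIFormula} {D : ℕ} {st : IState} {dep : ℕ → ℕ}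
    (hI : Inv C D st dep) {y z : ℕ} (h : Relation.TransGen (precRel st.prec) y z) :
    dep y < dep z := by
  induction h with
  | single h => have := hI.prec _ _ h; omega
  | tail _ h ih => have := hI.prec _ _ h; omega

/-- Adding labels at a variable. -/
theorem Inv.insert {C : Finset GIFormula} {D : ℕ} {st : IState} {dep : ℕ → ℕ}
    (hI : Inv C D st dep) {x : ℕ} {χ : GIFormula} (hχ : χ ∈ C) (hd : χ.md + dep x ≤ D) :
    Inv C D ⟨Insert.insert (IConstraint.sat x χ) st.cs, st.prec⟩ dep := by
  refine ⟨?_, ?_, hI.prec⟩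
  · intro z ψ h
    rcases Finset.mem_insert.1 h with h | h
    · cases h; exact ⟨hχ, hd⟩
    · exact hI.sat _ _ h
  · intro R a b h
    rcases Finset.mem_insert.1 h with h | h
    · cases h
    · exact hI.rel _ _ _ h

theorem csV_insert {S : Finset IConstraint} {x : ℕ} {χ : GIFormula} (hx : x ∈ csV S) :
    csV (insert (IConstraint.sat x χ) S) ⊆ csV S := by
  intro z hz
  obtain ⟨c, hc, hz⟩ := Finset.mem_biUnion.1 hz
  rcases Finset.mem_insert.1 hc with rfl | hc
  · simp only [IConstraint.vars, Finset.mem_singleton] at hz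
    rwa [hz]
  · exact mem_csV hc hz

theorem step_dec {C : Finset GIFormula} (hC : FClosed C) {D : ℕ} {st st' : IState} {dep : ℕ → ℕ}
    (hI : Inv C D st dep) (hs : IStep st st') :
    ∃ dep', Inv C D st' dep' ∧ Dec (2*D+2) (meas C st.cs dep) (meas C st'.cs dep') := by
  cases hs with
  | and x ψ₁ ψ₂ h h2 =>
    have hx : x ∈ csV st.cs := mem_csV h (by simp [IConstraint.vars])
    obtain ⟨hm, hmd⟩ := hI.sat _ _ h
    obtain ⟨hm1, hm2⟩ := hC.and _ _ hm
    simp only [GIFormula.md] at hmd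
    have hV := csV_insert (χ := ψ₂) hx
    have hx' : x ∈ csV (insert (IConstraint.sat x ψ₂) st.cs) :=
      mem_csV (Finset.mem_insert_self _ _) (by simp [IConstraint.vars])
    refine ⟨dep, (hI.insert (x := x) hm2 (by omega)).insert (x := x) hm1 (by omega), ?_⟩
    have hk : ∀ c ∈ st.cs, (∀ z ∈ c.vars, dep z ≤ dep x) →
      c ∈ insert (IConstraint.sat x ψ₁) (insert (IConstraint.sat x ψ₂) st.cs) :=
        fun c hc _ => by simp [hc]
    by_cases h1 : IConstraint.sat x ψ₁ ∈ st.cs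
    · exact dec_label (by omega) ((csV_insert hx').trans hV) hk hI.rel hx rfl hm2
        (fun h' => h2 ⟨h1, h'⟩) (by simp)
    · exact dec_label (by omega) ((csV_insert hx').trans hV) hk hI.rel hx rfl hm1
        h1 (by simp)
  | or x ψ₁ ψ₂ χ h h1 h2 hχ =>
    have hx : x ∈ csV st.cs := mem_csV h (by simp [IConstraint.vars])
    obtain ⟨hm, hmd⟩ := hI.sat _ _ h
    obtain ⟨hm1, hm2⟩ := hC.or _ _ hm
    simp only [GIFormula.md] at hmd
    have hk : ∀ c ∈ st.cs, (∀ z ∈ c.vars, dep z ≤ dep x) →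
      c ∈ insert (IConstraint.sat x χ) st.cs := fun c hc _ => by simp [hc]
    have hχC : χ ∈ C := by rcases hχ with rfl | rfl <;> assumption
    have hχm : χ.md + dep x ≤ D := by rcases hχ with rfl | rfl <;> omega
    have hχn : IConstraint.sat x χ ∉ st.cs := by rcases hχ with rfl | rfl <;> assumption
    exact ⟨dep, hI.insert hχC hχm, dec_label (by omega) (csV_insert hx) hk hI.rel hx rfl hχC
      hχn (by simp)⟩
  | choose S' P' x ω n ψ χ y h hr h1 h2 hχ hS' hP' =>
    obtain ⟨R, hR, hRxy⟩ := hr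
    have hy : y ∈ csV st.cs := mem_csV hRxy (by simp [IConstraint.vars])
    have hψ : ψ ∈ C ∧ ψ.md + 1 + dep x ≤ D := by
      rcases h with h | h
      · have := hI.sat _ _ h
        exact ⟨hC.ge _ _ _ this.1, this.2⟩
      · have := hI.sat _ _ h
        exact ⟨hC.le _ _ _ this.1, this.2⟩
    have hyx := hI.rel _ _ _ hRxy
    have hχC : χ ∈ C := by
      rcases hχ with rfl | rfl
      · exact hψ.1
      · exact hC.nn _ hψ.1
    have hχm : χ.md + dep y ≤ D := by
      rcases hχ with rfl | rfl
      · omega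
      · have := md_nnfNeg ψ; omega
    have hχn : IConstraint.sat y χ ∉ st.cs := by rcases hχ with rfl | rfl <;> assumption
    have hmem : ∀ c, c ∈ S' ↔ (c ∈ st.cs ∧ ∀ z ∈ c.vars,
        ¬ Relation.TransGen (precRel st.prec) y z) ∨ c = IConstraint.sat y χ := by
      intro c
      rw [← Finset.mem_coe, hS']
      simp [or_comm]
    have hpm : ∀ p, p ∈ P' → p ∈ st.prec := by
      intro p hp
      rw [← Finset.mem_coe, hP'] at hp
      exact hp.1
    refine ⟨dep, ⟨?_, ?_, ?_⟩, ?_⟩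
    · intro z θ hz
      rcases (hmem _).1 hz with hz | hz
      · exact hI.sat _ _ hz.1
      · cases hz; exact ⟨hχC, hχm⟩
    · intro R a b hz
      rcases (hmem _).1 hz with hz | hz
      · exact hI.rel _ _ _ hz.1
      · cases hz
    · intro a b hab
      exact hI.prec _ _ (hpm _ hab)
    · refine dec_label (d := dep y) (by omega) ?_ ?_ hI.rel hy rfl hχC hχn
        ((hmem _).2 (Or.inr rfl))
      · intro z hz
        obtain ⟨c, hc, hz⟩ := Finset.mem_biUnion.1 hz
        rcases (hmem _).1 hc with hc | rfl
        · exact mem_csV hc.1 hz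
        · simp only [IConstraint.vars, Finset.mem_singleton] at hz
          rwa [hz]
      · intro c hc hz
        refine (hmem _).2 (Or.inl ⟨hc, fun z hzc ht => ?_⟩)
        have := hI.desc ht
        have := hz z hzc
        omega
  | ge S' x ω n ψ y ρ f h hc hng hfresh hρ hf hS' =>
    have hx : x ∈ csV st.cs := mem_csV h (by simp [IConstraint.vars])
    have hyV : y ∉ csV st.cs := by
      intro hy
      obtain ⟨c, hc, hz⟩ := Finset.mem_biUnion.1 hy
      exact hfresh.1 c hc hz
    have hne : ∀ z ∈ csV st.cs, z ≠ y := fun z hz he => hyV (he ▸ hz)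
    obtain ⟨hm, hmd⟩ := hI.sat _ _ h
    have hmd' := hmd
    simp only [GIFormula.md] at hmd'
    have hmem : ∀ c, c ∈ S' ↔ ((c ∈ st.cs ∨ c = IConstraint.sat y ψ) ∨
        ∃ ψ' σ m,
            (IConstraint.sat x (.ge σ m ψ') ∈ st.cs ∨ IConstraint.sat x (.le σ m ψ') ∈ st.cs) ∧
            c = IConstraint.sat y (f ψ')) ∨
        ∃ R ∈ ρ, c = IConstraint.rel R x y ∨ c = IConstraint.rel R.inverse y x := by
      intro c
      rw [← Finset.mem_coe, hS']
      simp only [Set.mem_union, Set.mem_ofPred_eq, Set.mem_singleton_iff, Finset.mem_coe]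
    have hd : ∀ z, z ≠ y → Function.update dep y (dep x + 1) z = dep z :=
      fun z hz => Function.update_of_ne hz _ _
    have hdy : Function.update dep y (dep x + 1) y = dep x + 1 := Function.update_self _ _ _
    have hxy := hd x (hne x hx)
    refine ⟨Function.update dep y (dep x + 1), ⟨?_, ?_, ?_⟩, ?_⟩
    · intro z θ hz
      rcases (hmem _).1 hz with ((hz | hz) | ⟨ψ', σ, m, hq, he⟩) | ⟨R, _, hz | hz⟩
      · rw [hd z (hne z (mem_csV hz (by simp [IConstraint.vars])))]
        exact hI.sat _ _ hz
      · cases hz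
        rw [hdy]
        exact ⟨hC.ge _ _ _ hm, by omega⟩
      · cases he
        rw [hdy]
        have hψ : ψ' ∈ C ∧ ψ'.md + 1 + dep x ≤ D := by
          rcases hq with h | h
          · have := hI.sat _ _ h
            exact ⟨hC.ge _ _ _ this.1, this.2⟩
          · have := hI.sat _ _ h
            exact ⟨hC.le _ _ _ this.1, this.2⟩
        rcases hf ψ' with e | e
        · rw [e]; exact ⟨hψ.1, by omega⟩
        · rw [e]
          have := md_nnfNeg ψ'
          exact ⟨hC.nn _ hψ.1, by omega⟩
      · cases hz
      · cases hz
    · intro R a b hz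
      rcases (hmem _).1 hz with ((hz | hz) | ⟨ψ', σ, m, hq, he⟩) | ⟨R, _, hz | hz⟩
      · rw [hd a (hne a (mem_csV hz (by simp [IConstraint.vars]))),
          hd b (hne b (mem_csV hz (by simp [IConstraint.vars])))]
        exact hI.rel _ _ _ hz
      · cases hz
      · cases he
      · cases hz
        left; rw [hdy, hxy]
      · cases hz
        right; rw [hdy, hxy]
    · intro a b hab
      rcases Finset.mem_insert.1 hab with hab | hab
      · cases hab
        rw [hdy, hxy]
      · have := hfresh.2 _ hab
        rw [hd a this.1.symm, hd b this.2.symm]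
        exact hI.prec _ _ hab
    · refine dec_ge (d := dep x) (y := y) (x := x) (by omega) ?_ hdy
        (fun z hz => hd z (hne z hz)) (fun c hc => (hmem c).2 (Or.inl (Or.inl (Or.inl hc)))) hx rfl
        hm hc hyV (fun R hR => (hmem _).2 (Or.inr ⟨R, hρ hR, Or.inl rfl⟩))
        ((hmem _).2 (Or.inl (Or.inl (Or.inr rfl))))
      intro z hz
      obtain ⟨c, hc, hz⟩ := Finset.mem_biUnion.1 hz
      rw [Finset.mem_insert]
      rcases (hmem _).1 hc with ((hc | rfl) | ⟨ψ', σ, m, _, rfl⟩) | ⟨R, _, rfl | rfl⟩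
      · exact Or.inr (mem_csV hc hz)
      all_goals
        simp only [IConstraint.vars, Finset.mem_singleton, Finset.mem_insert] at hz
        first
          | exact Or.inl hz
          | (rcases hz with rfl | rfl
             · first
                | exact Or.inl rfl
                | exact Or.inr hx
             · first
                | exact Or.inl rfl
                | exact Or.inr hx)

end GrK

open GrK in
/-- termination of the Gr(K_{R⁻¹∩})-algorithm: there is no
infinite sequence of applications of the Gr(K_{R⁻¹∩}) completion rules
starting from ({x₀ ⊨ φ}, ∅), for φ in NNF. -/
theorem stmt_16 (φ : GIFormula) (hNNF : φ.isNNF) (x₀ : ℕ) :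
    ¬ ∃ f : ℕ → IState, f 0 = initI x₀ φ ∧ ∀ n, IStep (f n) (f (n + 1)) := by
  rintro ⟨F, h0, hstep⟩
  obtain ⟨C, hφ, hC⟩ := exists_closed_s16 φ hNNF
  have hinit : Inv C φ.md (F 0) (fun _ => 0) := by
    rw [h0]
    refine ⟨?_, ?_, ?_⟩
    · intro x ψ h
      simp only [initI, Finset.mem_singleton] at h
      cases h
      exact ⟨hφ, by simp⟩
    · intro R x y h
      simp [initI] at h
    · intro x y h
      simp [initI] at h
  have hnext : ∀ n (p : {dep // Inv C φ.md (F n) dep}),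
      ∃ q : {dep // Inv C φ.md (F (n+1)) dep},
        Dec (2*φ.md+2) (meas C (F n).cs p.1) (meas C (F (n+1)).cs q.1) := by
    intro n p
    obtain ⟨dep', h1, h2⟩ := step_dec hC p.2 (hstep n)
    exact ⟨⟨dep', h1⟩, h2⟩
  choose nx hnx using hnext
  let deps : ∀ n, {dep // Inv C φ.md (F n) dep} := fun n =>
    Nat.rec (motive := fun n => {dep // Inv C φ.md (F n) dep}) ⟨_, hinit⟩ nx n
  exact no_inf_dec (2*φ.md+2) (fun n => meas C (F n).cs (deps n).1) (fun n => hnx n (deps n))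
end
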